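/- arXiv:2508.15242 — 4 statements merged into one kernel-verified Lean document; each statement's English description precedes it below -/
import Mathlib

section
/- The relation ∼ is an equivalence relation on the class of finite R-modules: it is reflexive, symmetric, and transitive (this holds for an arbitrary, possibly nonabelian, finite group Γ₀). -/
/-- `𝒪` is one of the rings `ℤ`, `ℤ[1/2]`, or `ℤ_p` for some prime `p`. -/
def IsAllowedBase (𝒪 : Type) [CommRing 𝒪] : Prop :=
  Nonempty (𝒪 ≃+* ℤ) ∨ Nonempty (𝒪 ≃+* Localization.Away (2 : ℤ)) ∨
    ∃ (p : ℕ) (hp : p.Prime), Nonempty (𝒪 ≃+* @PadicInt p ⟨hp⟩)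

/-- A module `X` over `R` has projective dimension at most one: there is a
short exact sequence `0 → P₁ → P₀ → X → 0` with `P₀`, `P₁` projective. -/
def PdLeOne (R : Type) [Ring R] (X : Type) [AddCommGroup X] [Module R X] : Prop :=
  ∃ (P : Type) (_ : AddCommGroup P) (_ : Module R P) (f : P →ₗ[R] X),
    Function.Surjective f ∧ Module.Projective R P ∧
      Module.Projective R (LinearMap.ker f)

/-- Two finite `R`-modules `X` and `Y` are equivalent: there are finite `R`-modules
`M ≅ N` with three-step filtrations whose top and bottom layers have projective
dimension at most one and whose middle layers are `X` and `Y` respectively. -/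
def ModEquiv (R : Type) [Ring R]
    (X : Type) [AddCommGroup X] [Module R X]
    (Y : Type) [AddCommGroup Y] [Module R Y] : Prop :=
  ∃ (M : Type) (_ : AddCommGroup M) (_ : Module R M)
    (N : Type) (_ : AddCommGroup N) (_ : Module R N),
      Finite M ∧ Finite N ∧ Nonempty (M ≃ₗ[R] N) ∧
      ∃ (M' M'' : Submodule R M) (N' N'' : Submodule R N),
        M' ≤ M'' ∧ N' ≤ N'' ∧
        PdLeOne R M' ∧ PdLeOne R N' ∧
        PdLeOne R (M ⧸ M'') ∧ PdLeOne R (N ⧸ N'') ∧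
        Nonempty ((M'' ⧸ (M'.comap M''.subtype)) ≃ₗ[R] X) ∧
        Nonempty ((N'' ⧸ (N'.comap N''.subtype)) ≃ₗ[R] Y)

open Function LinearMap

section PdLeOne

variable {R : Type} [Ring R]

/-- Two surjections with the same kernel have isomorphic targets. -/
theorem nonempty_linearEquiv_of_ker_eq {T A B : Type} [AddCommGroup T] [Module R T]
    [AddCommGroup A] [Module R A] [AddCommGroup B] [Module R B]
    {a : T →ₗ[R] A} {b : T →ₗ[R] B} (ha : Surjective a) (hb : Surjective b)
    (h : ∀ t, a t = 0 ↔ b t = 0) : Nonempty (A ≃ₗ[R] B) := by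
  have hk : ker a = ker b := by ext t; exact h t
  exact ⟨(a.quotKerEquivOfSurjective ha).symm ≪≫ₗ Submodule.quotEquivOfEq _ _ hk ≪≫ₗ
    b.quotKerEquivOfSurjective hb⟩

/-- An extension of projective modules is projective. -/
theorem Module.Projective.of_surjective_of_ker {K C : Type} [AddCommGroup K] [Module R K]
    [AddCommGroup C] [Module R C] [Module.Projective R C] (f : K →ₗ[R] C) (hf : Surjective f)
    [Module.Projective R (ker f)] : Module.Projective R K := by
  obtain ⟨s, hs⟩ := Module.projective_lifting_property f LinearMap.id hf
  have hs' : ∀ c, f (s c) = c := LinearMap.congr_fun hs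
  refine Module.Projective.of_split
    ((LinearMap.codRestrict (ker f) (LinearMap.id - s ∘ₗ f) (by simp [hs'])).prod f)
    ((ker f).subtype.coprod s) ?_
  ext x
  simp

namespace PdLeOne

theorem of_linearEquiv {X Y : Type} [AddCommGroup X] [Module R X] [AddCommGroup Y] [Module R Y]
    (e : X ≃ₗ[R] Y) (h : PdLeOne R X) : PdLeOne R Y := by
  obtain ⟨P, _, _, f, hf, hP, hk⟩ := h
  refine ⟨P, _, _, e.toLinearMap ∘ₗ f, e.surjective.comp hf, hP, ?_⟩
  rwa [LinearEquiv.ker_comp]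

theorem of_subsingleton (X : Type) [AddCommGroup X] [Module R X] [Subsingleton X] :
    PdLeOne R X :=
  ⟨X, _, _, LinearMap.id, surjective_id, inferInstance, inferInstance⟩

/-- The horseshoe lemma for modules of projective dimension at most one. -/
theorem of_surjective_of_ker {B C : Type} [AddCommGroup B] [Module R B]
    [AddCommGroup C] [Module R C] (g : B →ₗ[R] C) (hg : Surjective g)
    (hA : PdLeOne R (ker g)) (hC : PdLeOne R C) : PdLeOne R B := by
  obtain ⟨P, _, _, a, ha, _, _⟩ := hA
  obtain ⟨Q, _, _, c, hc, _, _⟩ := hC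
  obtain ⟨d, hd⟩ := Module.projective_lifting_property g c hg
  have hd' : ∀ q, g (d q) = c q := LinearMap.congr_fun hd
  have hga : ∀ p, g (a p) = 0 := fun p => (a p).2
  let e : P × Q →ₗ[R] B := ((ker g).subtype ∘ₗ a).coprod d
  have he : ∀ p q, e (p, q) = a p + d q := fun p q => by simp [e]
  have hec : ∀ x ∈ ker e, c x.2 = 0 := by
    rintro ⟨p, q⟩ hx
    have := congrArg g ((he p q).symm.trans hx)
    simpa [hd', hga] using this
  let r : ker e →ₗ[R] ker c :=
    LinearMap.codRestrict (ker c) (LinearMap.snd R P Q ∘ₗ (ker e).subtype) fun x => hec x x.2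
  have hr : Surjective r := by
    rintro ⟨q, hq⟩
    obtain ⟨p, hp⟩ := ha ⟨d q, by rw [mem_ker, hd']; exact hq⟩
    refine ⟨⟨(-p, q), ?_⟩, rfl⟩
    rw [mem_ker, he, map_neg, hp]
    simp
  let i : ker a →ₗ[R] ker r :=
    LinearMap.codRestrict (ker r)
      (LinearMap.codRestrict (ker e) (LinearMap.inl R P Q ∘ₗ (ker a).subtype)
        fun p => by simp [he])
      fun p => by ext; rfl
  have hi : Bijective i := by
    refine ⟨fun p p' h => ?_, ?_⟩
    · exact Subtype.ext (congrArg (fun x : ker r => x.1.1.1) h)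
    · rintro ⟨⟨⟨p, q⟩, hpq⟩, hq⟩
      obtain rfl : q = 0 := congrArg Subtype.val hq
      have hp : a p = 0 := by
        have := (he p 0).symm.trans hpq
        simpa using this
      exact ⟨⟨p, hp⟩, rfl⟩
  have : Module.Projective R (ker r) := .of_equiv (LinearEquiv.ofBijective i hi)
  refine ⟨P × Q, _, _, e, fun b => ?_, inferInstance, .of_surjective_of_ker r hr⟩
  obtain ⟨q, hq⟩ := hc (g b)
  obtain ⟨p, hp⟩ := ha ⟨b - d q, by simp [hd', hq]⟩
  exact ⟨(p, q), by rw [he, hp]; simp⟩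

/-- An extension of `C` by a module `A`, presented as the image of `b : T → B`, has projective
dimension at most one when `A` and `C` do. -/
theorem of_exact {T A B C : Type} [AddCommGroup T] [Module R T]
    [AddCommGroup A] [Module R A] [AddCommGroup B] [Module R B] [AddCommGroup C] [Module R C]
    {a : T →ₗ[R] A} {b : T →ₗ[R] B} {g : B →ₗ[R] C} (ha : Surjective a)
    (hab : ∀ t, a t = 0 ↔ b t = 0) (hbg : Exact b g) (hg : Surjective g)
    (hA : PdLeOne R A) (hC : PdLeOne R C) : PdLeOne R B := by
  refine of_surjective_of_ker g hg ?_ hC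
  let b' : T →ₗ[R] ker g := LinearMap.codRestrict (ker g) b hbg.apply_apply_eq_zero
  have hb' : Surjective b' := by
    rintro ⟨x, hx⟩
    obtain ⟨t, rfl⟩ := (hbg x).1 hx
    exact ⟨t, rfl⟩
  obtain ⟨e⟩ := nonempty_linearEquiv_of_ker_eq ha hb' fun t => by
    rw [hab, ← Subtype.coe_inj]; rfl
  exact hA.of_linearEquiv e

end PdLeOne

/-- Given a submodule `i : B → M` whose cokernel has projective dimension at most one, every
surjection `π : F → B` extends to a surjection `ρ : G → M` with the same kernel: the obstruction
to doing so lies in an `Ext²` group that vanishes. -/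
theorem PdLeOne.exists_extension {F B M : Type} [AddCommGroup F] [Module R F]
    [AddCommGroup B] [Module R B] [AddCommGroup M] [Module R M]
    (i : B →ₗ[R] M) (hi : Injective i) (π : F →ₗ[R] B) (hπ : Surjective π)
    (hM : PdLeOne R (M ⧸ range i)) :
    ∃ (G : Type) (_ : AddCommGroup G) (_ : Module R G) (j : F →ₗ[R] G) (ρ : G →ₗ[R] M),
      Injective j ∧ Surjective ρ ∧ (∀ x, ρ (j x) = i (π x)) ∧
      ∀ y, ρ y ∈ range i → y ∈ range j := by
  obtain ⟨P, _, _, f, hf, _, _⟩ := hM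
  obtain ⟨g, hg⟩ := Module.projective_lifting_property (range i).mkQ f
    (Submodule.mkQ_surjective _)
  have hg' : ∀ p, (range i).mkQ (g p) = f p := LinearMap.congr_fun hg
  have hgi : ∀ p, f p = 0 ↔ g p ∈ range i := fun p => by
    rw [← hg', Submodule.mkQ_apply, Submodule.Quotient.mk_eq_zero]
  let iB : B ≃ₗ[R] range i := LinearEquiv.ofInjective i hi
  let gQ : ker f →ₗ[R] B := iB.symm.toLinearMap ∘ₗ
    LinearMap.codRestrict (range i) (g ∘ₗ (ker f).subtype) fun p => (hgi p).1 p.2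
  have hgQ : ∀ p : ker f, i (gQ p) = g p := fun p => by
    have : iB (gQ p) = ⟨g p, (hgi p).1 p.2⟩ := iB.apply_symm_apply _
    exact congrArg Subtype.val this
  obtain ⟨h, hh⟩ := Module.projective_lifting_property π gQ hπ
  have hh' : ∀ p : ker f, i (π (h p)) = g p := fun p => by
    rw [← hgQ, ← hh]; rfl
  let r : ker f →ₗ[R] F × P := (-h).prod (ker f).subtype
  let ρ : ((F × P) ⧸ range r) →ₗ[R] M := (range r).liftQ ((i ∘ₗ π).coprod g) (by
    rintro _ ⟨p, rfl⟩
    simp [r, hh'])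
  have hρ : ∀ x p, ρ ((range r).mkQ (x, p)) = i (π x) + g p := fun x p => by
    simp [ρ]
  refine ⟨(F × P) ⧸ range r, _, _, (range r).mkQ ∘ₗ LinearMap.inl R F P, ρ, ?_, ?_, ?_, ?_⟩
  · rw [injective_iff_map_eq_zero]
    intro x hx
    obtain ⟨p, hp⟩ := (Submodule.Quotient.mk_eq_zero (range r)).1 hx
    have h2 : p = 0 := Subtype.ext (congrArg Prod.snd hp)
    have h1 : -h p = x := congrArg Prod.fst hp
    simpa [h2] using h1.symm
  · intro m
    obtain ⟨p, hp⟩ := hf ((range i).mkQ m)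
    rw [← hg'] at hp
    obtain ⟨b, hb⟩ := (Submodule.Quotient.eq (range i)).1 hp.symm
    obtain ⟨x, rfl⟩ := hπ b
    exact ⟨(range r).mkQ (x, p), by rw [hρ, hb]; abel⟩
  · intro x
    simpa using hρ x 0
  · intro y hy
    obtain ⟨⟨x, p⟩, rfl⟩ := Submodule.mkQ_surjective _ y
    rw [hρ] at hy
    have hp : f p = 0 := (hgi p).2 <| by
      simpa using sub_mem hy (LinearMap.mem_range_self i (π x))
    refine ⟨x + h ⟨p, hp⟩, ?_⟩
    refine (Submodule.Quotient.eq (range r)).2 ⟨-⟨p, hp⟩, ?_⟩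
    simp [r]

/-- The pushout of two injections. -/
theorem exists_pushout_of_injective {F G H : Type} [AddCommGroup F] [Module R F]
    [AddCommGroup G] [Module R G] [AddCommGroup H] [Module R H] [Finite G] [Finite H]
    (a : F →ₗ[R] G) (b : F →ₗ[R] H) (ha : Injective a) (hb : Injective b) :
    ∃ (W : Type) (_ : AddCommGroup W) (_ : Module R W) (u : G →ₗ[R] W) (v : H →ₗ[R] W),
      Finite W ∧ Injective u ∧ Injective v ∧ (∀ w, ∃ x y, w = u x + v y) ∧
      (∀ x, u x ∈ range v ↔ x ∈ range a) ∧ ∀ y, v y ∈ range u ↔ y ∈ range b := by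
  let r : F →ₗ[R] G × H := a.prod (-b)
  let u : G →ₗ[R] (G × H) ⧸ range r := (range r).mkQ ∘ₗ LinearMap.inl R G H
  let v : H →ₗ[R] (G × H) ⧸ range r := (range r).mkQ ∘ₗ LinearMap.inr R G H
  have hr : ∀ x y, u x = v y ↔ ∃ z, a z = x ∧ b z = y := fun x y =>
    (Submodule.Quotient.eq (range r)).trans <| by
      simp [r, Prod.ext_iff]
  refine ⟨(G × H) ⧸ range r, _, _, u, v,
    Finite.of_surjective _ (Submodule.mkQ_surjective (range r)), ?_, ?_, ?_, ?_, ?_⟩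
  · rw [injective_iff_map_eq_zero]
    intro x hx
    obtain ⟨z, rfl, hz⟩ := (hr x 0).1 (by simpa using hx)
    rw [hb (hz.trans (map_zero b).symm), map_zero]
  · rw [injective_iff_map_eq_zero]
    intro y hy
    obtain ⟨z, hz, rfl⟩ := (hr 0 y).1 (by simpa using hy.symm)
    rw [ha (hz.trans (map_zero a).symm), map_zero]
  · intro w
    obtain ⟨⟨x, y⟩, rfl⟩ := Submodule.mkQ_surjective _ w
    refine ⟨x, y, ?_⟩
    simp only [u, v, LinearMap.comp_apply, ← map_add]
    simp
  · refine fun x => ⟨fun ⟨y, hy⟩ => ?_, fun ⟨z, hz⟩ => ⟨b z, ((hr _ _).2 ⟨z, hz, rfl⟩).symm⟩⟩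
    obtain ⟨z, hz, -⟩ := (hr x y).1 hy.symm
    exact ⟨z, hz⟩
  · refine fun y => ⟨fun ⟨x, hx⟩ => ?_, fun ⟨z, hz⟩ => ⟨a z, (hr _ _).2 ⟨z, rfl, hz⟩⟩⟩
    obtain ⟨z, -, hz⟩ := (hr x y).1 hx
    exact ⟨z, hz⟩

theorem Module.finite_of_finite_range_of_finite_ker {G M : Type} [AddCommGroup G] [Module R G]
    [AddCommGroup M] [Module R M] (f : G →ₗ[R] M) [Finite M] [Finite (ker f)] : Finite G := by
  have : Finite (G ⧸ ker f) := Finite.of_equiv _ f.quotKerEquivRange.symm.toEquiv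
  have : Finite (G ⧸ (ker f).toAddSubgroup) := this
  have : Finite (ker f).toAddSubgroup := ‹Finite (ker f)›
  exact Finite.of_addSubgroup_quotient (ker f).toAddSubgroup

end PdLeOne

/-- `X` is the middle layer of a three-step filtration of `M` whose outer layers have projective
dimension at most one; here `S` is the middle step of the filtration. -/
def IsMiddleLayer (R : Type) [Ring R] (X : Type) [AddCommGroup X] [Module R X]
    (M : Type) [AddCommGroup M] [Module R M] : Prop :=
  ∃ (S : Type) (_ : AddCommGroup S) (_ : Module R S) (i : S →ₗ[R] M) (π : S →ₗ[R] X),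
    Injective i ∧ Surjective π ∧ PdLeOne R (ker π) ∧ PdLeOne R (M ⧸ range i)

namespace IsMiddleLayer

variable {R : Type} [Ring R] {X Y M K : Type} [AddCommGroup X] [Module R X]
  [AddCommGroup Y] [Module R Y] [AddCommGroup M] [Module R M] [AddCommGroup K] [Module R K]

theorem refl : IsMiddleLayer R X X := by
  refine ⟨X, _, _, LinearMap.id, LinearMap.id, injective_id, surjective_id, ?_, ?_⟩
  · rw [LinearMap.ker_id]
    exact .of_subsingleton _
  · rw [LinearMap.range_id]
    exact .of_subsingleton _

theorem of_linearEquiv (e : M ≃ₗ[R] K) (h : IsMiddleLayer R X M) : IsMiddleLayer R X K := by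
  obtain ⟨S, _, _, i, π, hi, hπ, h₁, h₂⟩ := h
  refine ⟨S, _, _, e.toLinearMap ∘ₗ i, π, e.injective.comp hi, hπ, h₁, h₂.of_linearEquiv ?_⟩
  exact Submodule.Quotient.equiv _ _ e (LinearMap.range_comp i e.toLinearMap).symm

theorem trans (h : IsMiddleLayer R X M) (h' : IsMiddleLayer R M K) : IsMiddleLayer R X K := by
  obtain ⟨S, _, _, i, π, hi, hπ, h₁, h₂⟩ := h
  obtain ⟨T, _, _, j, ρ, hj, hρ, h₃, h₄⟩ := h'
  let U := eqLocus (ρ ∘ₗ LinearMap.fst R T S) (i ∘ₗ LinearMap.snd R T S)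
  have hU : ∀ x : U, ρ x.1.1 = i x.1.2 := fun x => x.2
  let k : U →ₗ[R] K := j ∘ₗ LinearMap.fst R T S ∘ₗ U.subtype
  let σ : U →ₗ[R] X := π ∘ₗ LinearMap.snd R T S ∘ₗ U.subtype
  have hk : ∀ t, j t ∈ range k ↔ ρ t ∈ range i := by
    refine fun t => ⟨fun ⟨x, hx⟩ => ?_, fun ⟨s, hs⟩ => ⟨⟨(t, s), hs.symm⟩, rfl⟩⟩
    obtain rfl := hj hx
    exact ⟨_, (hU x).symm⟩
  refine ⟨U, _, _, k, σ, ?_, ?_, ?_, ?_⟩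
  · intro x y hxy
    have h1 : x.1.1 = y.1.1 := hj hxy
    exact Subtype.ext (Prod.ext h1 (hi (by rw [← hU, ← hU, h1])))
  · intro x
    obtain ⟨s, rfl⟩ := hπ x
    obtain ⟨t, ht⟩ := hρ (i s)
    exact ⟨⟨(t, s), ht⟩, rfl⟩
  · let b : ker ρ →ₗ[R] ker σ :=
      LinearMap.codRestrict (ker σ)
        (LinearMap.codRestrict U (LinearMap.inl R T S ∘ₗ (ker ρ).subtype)
          fun t => by simp [U])
        fun t => map_zero π
    let g : ker σ →ₗ[R] ker π :=
      LinearMap.codRestrict (ker π) (LinearMap.snd R T S ∘ₗ U.subtype ∘ₗ (ker σ).subtype)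
        fun x => x.2
    refine PdLeOne.of_exact (a := LinearMap.id) (b := b) (g := g) surjective_id ?_ ?_ ?_ h₃ h₁
    · refine fun t => ⟨fun h => by rw [show t = 0 from h, map_zero], fun h => ?_⟩
      exact Subtype.ext (congrArg (fun x : ker σ => x.1.1.1) h)
    · rintro ⟨⟨⟨t, s⟩, hts⟩, hs⟩
      constructor
      · intro h
        obtain rfl : s = 0 := congrArg Subtype.val h
        exact ⟨⟨t, (hU ⟨(t, 0), hts⟩).trans (map_zero i)⟩, rfl⟩
      · rintro ⟨t', ht'⟩
        exact Subtype.ext (congrArg (fun x : ker σ => x.1.1.2) ht').symm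
    · rintro ⟨s, hs⟩
      obtain ⟨t, ht⟩ := hρ (i s)
      exact ⟨⟨⟨(t, s), ht⟩, hs⟩, rfl⟩
  · have hkj : range k ≤ range j := by
      rintro _ ⟨x, rfl⟩
      exact ⟨_, rfl⟩
    refine PdLeOne.of_exact (a := (range i).mkQ ∘ₗ ρ) (b := (range k).mkQ ∘ₗ j)
      (g := Submodule.factor hkj) ((Submodule.mkQ_surjective _).comp hρ) ?_ ?_
      (Submodule.factor_surjective hkj) h₂ h₄
    · intro t
      simp [← hk, -mem_range]
    · intro y
      obtain ⟨y, rfl⟩ := Submodule.mkQ_surjective _ y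
      refine (Submodule.Quotient.mk_eq_zero (range j)).trans ?_
      constructor
      · rintro ⟨t, rfl⟩
        exact ⟨t, rfl⟩
      · rintro ⟨t, ht⟩
        have := hkj ((Submodule.Quotient.eq (range k)).1 ht)
        simpa using sub_mem (LinearMap.mem_range_self j t) this

/-- A finite form of `PdLeOne.exists_extension` that keeps track of kernel and cokernel. -/
theorem exists_extension [Finite M] {F S : Type}
    [AddCommGroup F] [Module R F] [AddCommGroup S] [Module R S] [Finite F] (i : S →ₗ[R] M) (hi : Injective i) (p : F →ₗ[R] S) (hp : Surjective p)
    (h : PdLeOne R (ker p)) (hM : PdLeOne R (M ⧸ range i)) :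
    ∃ (G : Type) (_ : AddCommGroup G) (_ : Module R G) (j : F →ₗ[R] G) (ρ : G →ₗ[R] M),
      Finite G ∧ Injective j ∧ Surjective ρ ∧ PdLeOne R (ker ρ) ∧ PdLeOne R (G ⧸ range j) := by
  obtain ⟨G, _, _, j, ρ, hj, hρ, hc, hr⟩ := hM.exists_extension i hi p hp
  let b : ker p →ₗ[R] ker ρ := LinearMap.codRestrict (ker ρ) (j ∘ₗ (ker p).subtype)
    fun x => by simp [hc]
  have hb : Bijective b := by
    refine ⟨fun x y hxy => Subtype.ext (hj (congrArg Subtype.val hxy)), ?_⟩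
    rintro ⟨y, hy⟩
    rw [mem_ker] at hy
    obtain ⟨x, rfl⟩ := hr y (by rw [hy]; exact zero_mem _)
    exact ⟨⟨x, hi (by rw [← hc, hy, map_zero])⟩, rfl⟩
  have : Finite (ker ρ) := Finite.of_surjective b hb.2
  obtain ⟨e⟩ := nonempty_linearEquiv_of_ker_eq (a := (range i).mkQ ∘ₗ ρ) (b := (range j).mkQ)
    ((Submodule.mkQ_surjective _).comp hρ) (Submodule.mkQ_surjective _) fun y => by
      simp only [LinearMap.comp_apply, Submodule.mkQ_apply, Submodule.Quotient.mk_eq_zero]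
      refine ⟨hr y, ?_⟩
      rintro ⟨x, rfl⟩
      exact ⟨p x, (hc x).symm⟩
  exact ⟨G, _, _, j, ρ, Module.finite_of_finite_range_of_finite_ker ρ, hj, hρ,
    h.of_linearEquiv (LinearEquiv.ofBijective b hb), hM.of_linearEquiv e⟩

/-- Two finite modules with a common middle layer are middle layers of a common finite module. -/
theorem exists_common [Finite M] [Finite K] (h : IsMiddleLayer R Y M) (h' : IsMiddleLayer R Y K) :
    ∃ (W : Type) (_ : AddCommGroup W) (_ : Module R W),
      Finite W ∧ IsMiddleLayer R M W ∧ IsMiddleLayer R K W := by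
  obtain ⟨S, _, _, i, π, hi, hπ, h₁, h₂⟩ := h
  obtain ⟨T, _, _, j, ρ, hj, hρ, h₃, h₄⟩ := h'
  have : Finite S := Finite.of_injective i hi
  have : Finite T := Finite.of_injective j hj
  let F := eqLocus (π ∘ₗ LinearMap.fst R S T) (ρ ∘ₗ LinearMap.snd R S T)
  have hF : ∀ x : F, π x.1.1 = ρ x.1.2 := fun x => x.2
  let p : F →ₗ[R] S := LinearMap.fst R S T ∘ₗ F.subtype
  let q : F →ₗ[R] T := LinearMap.snd R S T ∘ₗ F.subtype
  have hp : Surjective p := fun s => by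
    obtain ⟨t, ht⟩ := hρ (π s)
    exact ⟨⟨(s, t), ht.symm⟩, rfl⟩
  have hq : Surjective q := fun t => by
    obtain ⟨s, hs⟩ := hπ (ρ t)
    exact ⟨⟨(s, t), hs⟩, rfl⟩
  have hpk : PdLeOne R (ker p) := by
    refine h₃.of_linearEquiv (LinearEquiv.ofBijective
      (LinearMap.codRestrict (ker p)
        (LinearMap.codRestrict F (LinearMap.inr R S T ∘ₗ (ker ρ).subtype)
          fun t => by simp [F])
        fun t => rfl) ⟨fun x y hxy => ?_, ?_⟩)
    · exact Subtype.ext (congrArg (fun x : ker p => x.1.1.2) hxy)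
    · rintro ⟨⟨⟨s, t⟩, hst⟩, hs⟩
      obtain rfl : s = 0 := hs
      exact ⟨⟨t, (hF ⟨(0, t), hst⟩).symm.trans (map_zero π)⟩, rfl⟩
  have hqk : PdLeOne R (ker q) := by
    refine h₁.of_linearEquiv (LinearEquiv.ofBijective
      (LinearMap.codRestrict (ker q)
        (LinearMap.codRestrict F (LinearMap.inl R S T ∘ₗ (ker π).subtype)
          fun t => by simp [F])
        fun t => rfl) ⟨fun x y hxy => ?_, ?_⟩)
    · exact Subtype.ext (congrArg (fun x : ker q => x.1.1.1) hxy)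
    · rintro ⟨⟨⟨s, t⟩, hst⟩, ht⟩
      obtain rfl : t = 0 := ht
      have hs : π s = 0 := (hF ⟨(s, 0), hst⟩).trans (map_zero ρ)
      exact ⟨⟨s, hs⟩, rfl⟩
  obtain ⟨G, _, _, a, μ, _, ha, hμ, hμk, hac⟩ := exists_extension i hi p hp hpk h₂
  obtain ⟨H, _, _, b, ν, _, hb, hν, hνk, hbc⟩ := exists_extension j hj q hq hqk h₄
  obtain ⟨W, _, _, u, v, hW, hu, hv, huv, hur, hvr⟩ := exists_pushout_of_injective a b ha hb
  refine ⟨W, _, _, hW, ⟨G, _, _, u, μ, hu, hμ, hμk, ?_⟩, ⟨H, _, _, v, ν, hv, hν, hνk, ?_⟩⟩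
  · obtain ⟨e⟩ := nonempty_linearEquiv_of_ker_eq (a := (range b).mkQ) (b := (range u).mkQ ∘ₗ v)
      (Submodule.mkQ_surjective _) (fun w => by
        obtain ⟨w, rfl⟩ := Submodule.mkQ_surjective _ w
        obtain ⟨x, y, rfl⟩ := huv w
        exact ⟨y, (Submodule.Quotient.eq (range u)).2 ⟨-x, by simp⟩⟩) fun y => by
      simp [← hvr, -mem_range]
    exact hbc.of_linearEquiv e
  · obtain ⟨e⟩ := nonempty_linearEquiv_of_ker_eq (a := (range a).mkQ) (b := (range v).mkQ ∘ₗ u)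
      (Submodule.mkQ_surjective _) (fun w => by
        obtain ⟨w, rfl⟩ := Submodule.mkQ_surjective _ w
        obtain ⟨x, y, rfl⟩ := huv w
        exact ⟨x, (Submodule.Quotient.eq (range v)).2 ⟨-y, by simp⟩⟩) fun x => by
      simp [← hur, -mem_range]
    exact hac.of_linearEquiv e

theorem of_filtration {M' M'' : Submodule R M} (hM : M' ≤ M'') (h' : PdLeOne R M')
    (h'' : PdLeOne R (M ⧸ M'')) (e : (M'' ⧸ M'.comap M''.subtype) ≃ₗ[R] X) :
    IsMiddleLayer R X M := by
  refine ⟨M'', _, _, M''.subtype, e.toLinearMap ∘ₗ (M'.comap M''.subtype).mkQ,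
    M''.injective_subtype, e.surjective.comp (Submodule.mkQ_surjective _), ?_, ?_⟩
  · rw [LinearEquiv.ker_comp, Submodule.ker_mkQ]
    exact h'.of_linearEquiv (Submodule.comapSubtypeEquivOfLe hM).symm
  · rwa [Submodule.range_subtype]

theorem exists_filtration (h : IsMiddleLayer R X M) :
    ∃ M' M'' : Submodule R M, M' ≤ M'' ∧ PdLeOne R M' ∧ PdLeOne R (M ⧸ M'') ∧
      Nonempty ((M'' ⧸ M'.comap M''.subtype) ≃ₗ[R] X) := by
  obtain ⟨S, _, _, i, π, hi, hπ, h₁, h₂⟩ := h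
  refine ⟨(ker π).map i, range i, LinearMap.map_le_range,
    h₁.of_linearEquiv (Submodule.equivMapOfInjective i hi _), h₂, ?_⟩
  refine nonempty_linearEquiv_of_ker_eq (a := Submodule.mkQ _ ∘ₗ i.rangeRestrict)
    ((Submodule.mkQ_surjective _).comp i.surjective_rangeRestrict) hπ fun s => ?_
  simp [hi.eq_iff]

end IsMiddleLayer

theorem modEquiv_iff_exists_isMiddleLayer {R : Type} [Ring R] {X Y : Type}
    [AddCommGroup X] [Module R X] [AddCommGroup Y] [Module R Y] :
    ModEquiv R X Y ↔ ∃ (M : Type) (_ : AddCommGroup M) (_ : Module R M),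
      Finite M ∧ IsMiddleLayer R X M ∧ IsMiddleLayer R Y M := by
  constructor
  · rintro ⟨M, _, _, N, _, _, hM, -, ⟨e⟩, M', M'', N', N'', hMM, hNN, h₁, h₂, h₃, h₄, ⟨eX⟩, ⟨eY⟩⟩
    exact ⟨M, _, _, hM, .of_filtration hMM h₁ h₃ eX,
      (IsMiddleLayer.of_filtration hNN h₂ h₄ eY).of_linearEquiv e.symm⟩
  · rintro ⟨M, _, _, hM, hX, hY⟩
    obtain ⟨M', M'', hMM, h₁, h₃, eX⟩ := hX.exists_filtration
    obtain ⟨N', N'', hNN, h₂, h₄, eY⟩ := hY.exists_filtration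
    exact ⟨M, _, _, M, _, _, hM, hM, ⟨.refl R M⟩, M', M'', N', N'', hMM, hNN, h₁, h₂, h₃, h₄,
      eX, eY⟩

/-- The relation `∼` is an equivalence relation on finite `R`-modules,
`R = 𝒪[Γ₀]` with `Γ₀` a finite (possibly nonabelian) group. -/
theorem modEquiv_is_equivalence
    (𝒪 : Type) [CommRing 𝒪] (h𝒪 : IsAllowedBase 𝒪)
    (Γ₀ : Type) [Group Γ₀] [Finite Γ₀] :
    (∀ (X : Type) (_ : AddCommGroup X) (_ : Module (MonoidAlgebra 𝒪 Γ₀) X),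
        Finite X → ModEquiv (MonoidAlgebra 𝒪 Γ₀) X X) ∧
    (∀ (X : Type) (_ : AddCommGroup X) (_ : Module (MonoidAlgebra 𝒪 Γ₀) X)
        (Y : Type) (_ : AddCommGroup Y) (_ : Module (MonoidAlgebra 𝒪 Γ₀) Y),
        Finite X → Finite Y →
        ModEquiv (MonoidAlgebra 𝒪 Γ₀) X Y → ModEquiv (MonoidAlgebra 𝒪 Γ₀) Y X) ∧
    (∀ (X : Type) (_ : AddCommGroup X) (_ : Module (MonoidAlgebra 𝒪 Γ₀) X)
        (Y : Type) (_ : AddCommGroup Y) (_ : Module (MonoidAlgebra 𝒪 Γ₀) Y)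
        (Z : Type) (_ : AddCommGroup Z) (_ : Module (MonoidAlgebra 𝒪 Γ₀) Z),
        Finite X → Finite Y → Finite Z →
        ModEquiv (MonoidAlgebra 𝒪 Γ₀) X Y → ModEquiv (MonoidAlgebra 𝒪 Γ₀) Y Z →
        ModEquiv (MonoidAlgebra 𝒪 Γ₀) X Z) := by
  simp only [modEquiv_iff_exists_isMiddleLayer]
  refine ⟨fun X _ _ hX => ⟨X, _, _, hX, .refl, .refl⟩, ?_, ?_⟩
  · rintro X _ _ Y _ _ - - ⟨M, _, _, hM, h, h'⟩
    exact ⟨M, _, _, hM, h', h⟩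
  · rintro X _ _ Y _ _ Z _ _ - - - ⟨M, _, _, _, hX, hY⟩ ⟨K, _, _, _, hY', hZ⟩
    obtain ⟨W, _, _, hW, hM, hK⟩ := hY.exists_common hY'
    exact ⟨W, _, _, hW, hX.trans hM, hZ.trans hK⟩
end

section
/- Let X and Y be finite R-modules with X ∼ Y. Suppose 0 → K → F → X → 0 and 0 → K' → F' → Y → 0 are short exact sequences of R-modules in which F and F' are finitely generated projective. Then the R-lattices K and K' are projectively equivalent. (In particular, the class of K up to projective equivalence depends only on the equivalence class of X, so the syzygy map Φ on equivalence classes is well defined.) -/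
/-- Two `R`-modules are projectively equivalent if they become isomorphic after
adding finitely generated projective direct summands. -/
def ProjEquiv (R : Type) [Ring R]
    (L : Type) [AddCommGroup L] [Module R L]
    (L' : Type) [AddCommGroup L'] [Module R L'] : Prop :=
  ∃ (F : Type) (_ : AddCommGroup F) (_ : Module R F)
    (F' : Type) (_ : AddCommGroup F') (_ : Module R F'),
      Module.Finite R F ∧ Module.Projective R F ∧
      Module.Finite R F' ∧ Module.Projective R F' ∧
      Nonempty ((L × F') ≃ₗ[R] (L' × F))

section Ring

variable {R : Type} [Ring R]

/-- A common form of Schanuel's lemma: two maps to `X` which factor through each other. -/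
def LinearMap.kerProdEquivOfFactor {X A B : Type} [AddCommGroup X] [Module R X]
    [AddCommGroup A] [Module R A] [AddCommGroup B] [Module R B]
    (p : A →ₗ[R] X) (q : B →ₗ[R] X) (h : B →ₗ[R] A) (h' : A →ₗ[R] B)
    (hh : ∀ b, p (h b) = q b) (hh' : ∀ a, q (h' a) = p a) :
    (LinearMap.ker p × B) ≃ₗ[R] (LinearMap.ker q × A) where
  toFun x := (⟨x.2 - h' (x.1 + h x.2), by
    have := x.1.2
    rw [LinearMap.mem_ker] at this ⊢
    simp [hh, hh', this]⟩, x.1 + h x.2)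
  invFun x := (⟨x.2 - h (x.1 + h' x.2), by
    have := x.1.2
    rw [LinearMap.mem_ker] at this ⊢
    simp [hh, hh', this]⟩, x.1 + h' x.2)
  map_add' x y := by
    ext <;> simp <;> abel
  map_smul' r x := by
    ext <;> simp [smul_sub]
  left_inv x := by
    ext <;> simp
  right_inv x := by
    ext <;> simp

theorem LinearMap.nonempty_kerProdEquiv {X A B : Type} [AddCommGroup X] [Module R X]
    [AddCommGroup A] [Module R A] [AddCommGroup B] [Module R B]
    [Module.Projective R A] [Module.Projective R B]
    (p : A →ₗ[R] X) (q : B →ₗ[R] X) (hp : Function.Surjective p) (hq : Function.Surjective q) :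
    Nonempty ((LinearMap.ker p × B) ≃ₗ[R] (LinearMap.ker q × A)) := by
  obtain ⟨h, hh⟩ := Module.projective_lifting_property p q hp
  obtain ⟨h', hh'⟩ := Module.projective_lifting_property q p hq
  exact ⟨LinearMap.kerProdEquivOfFactor p q h h' (fun b => LinearMap.congr_fun hh b)
    (fun a => LinearMap.congr_fun hh' a)⟩

theorem PdLeOne.projective_ker {X A : Type} [AddCommGroup X] [Module R X]
    [AddCommGroup A] [Module R A] [Module.Projective R A] (hX : PdLeOne R X)
    (p : A →ₗ[R] X) (hp : Function.Surjective p) : Module.Projective R (LinearMap.ker p) := by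
  obtain ⟨P, _, _, f, hf, hP, hK⟩ := hX
  obtain ⟨e⟩ := LinearMap.nonempty_kerProdEquiv p f hp hf
  have : Module.Projective R (LinearMap.ker p × P) := Module.Projective.of_equiv e.symm
  exact Module.Projective.of_split (LinearMap.inl R _ P) (LinearMap.fst R _ P) (by ext; simp)

theorem ProjEquiv.of_linearEquiv {L L' : Type} [AddCommGroup L] [Module R L]
    [AddCommGroup L'] [Module R L'] (e : L ≃ₗ[R] L') : ProjEquiv R L L' :=
  ⟨PUnit, inferInstance, inferInstance, PUnit, inferInstance, inferInstance, inferInstance,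
    inferInstance, inferInstance, inferInstance, ⟨e.prodCongr (LinearEquiv.refl R _)⟩⟩

theorem ProjEquiv.symm {L L' : Type} [AddCommGroup L] [Module R L]
    [AddCommGroup L'] [Module R L'] (h : ProjEquiv R L L') : ProjEquiv R L' L := by
  obtain ⟨F, _, _, F', _, _, h1, h2, h3, h4, ⟨e⟩⟩ := h
  exact ⟨F', _, _, F, _, _, h3, h4, h1, h2, ⟨e.symm⟩⟩

theorem ProjEquiv.trans {L L' L'' : Type} [AddCommGroup L] [Module R L]
    [AddCommGroup L'] [Module R L'] [AddCommGroup L''] [Module R L'']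
    (h : ProjEquiv R L L') (h' : ProjEquiv R L' L'') : ProjEquiv R L L'' := by
  obtain ⟨F, _, _, F', _, _, h1, h2, h3, h4, ⟨e⟩⟩ := h
  obtain ⟨G, _, _, G', _, _, k1, k2, k3, k4, ⟨f⟩⟩ := h'
  refine ⟨G × F, inferInstance, inferInstance, F' × G', inferInstance, inferInstance,
    inferInstance, inferInstance, inferInstance, inferInstance, ⟨?_⟩⟩
  exact (LinearEquiv.prodAssoc R L F' G').symm ≪≫ₗ
    e.prodCongr (LinearEquiv.refl R G') ≪≫ₗ
    LinearEquiv.prodAssoc R L' F G' ≪≫ₗ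
    (LinearEquiv.refl R L').prodCongr (LinearEquiv.prodComm R F G') ≪≫ₗ
    (LinearEquiv.prodAssoc R L' G' F).symm ≪≫ₗ
    f.prodCongr (LinearEquiv.refl R F) ≪≫ₗ
    LinearEquiv.prodAssoc R L'' G F

/-- The syzygy of a module with respect to finitely generated projective covers is well defined
up to projective equivalence. -/
theorem projEquiv_ker_ker {X A B : Type} [AddCommGroup X] [Module R X]
    [AddCommGroup A] [Module R A] [AddCommGroup B] [Module R B]
    [Module.Finite R A] [Module.Finite R B]
    [Module.Projective R A] [Module.Projective R B]
    (p : A →ₗ[R] X) (q : B →ₗ[R] X) (hp : Function.Surjective p) (hq : Function.Surjective q) :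
    ProjEquiv R (LinearMap.ker p) (LinearMap.ker q) :=
  ⟨A, inferInstance, inferInstance, B, inferInstance, inferInstance, inferInstance,
    inferInstance, inferInstance, inferInstance, LinearMap.nonempty_kerProdEquiv p q hp hq⟩

end Ring

section GroupRing

variable {𝒪 : Type} [CommRing 𝒪] {G : Type} [Group G]

open MonoidAlgebra in
/-- A projective module over a group ring of a finite group has an endomorphism over the base
whose trace is the identity. -/
theorem exists_sum_conj_eq_self [Fintype G] (Q : Type) [AddCommGroup Q]
    [Module (MonoidAlgebra 𝒪 G) Q] [Module 𝒪 Q] [IsScalarTower 𝒪 (MonoidAlgebra 𝒪 G) Q]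
    [Module.Projective (MonoidAlgebra 𝒪 G) Q] :
    ∃ θ : Q →ₗ[𝒪] Q, ∀ x : Q,
      ∑ g : G, single g (1 : 𝒪) • θ (single g⁻¹ (1 : 𝒪) • x) = x := by
  obtain ⟨s, hs⟩ := Module.projective_def.mp ‹Module.Projective (MonoidAlgebra 𝒪 G) Q›
  let c : MonoidAlgebra 𝒪 G →ₗ[𝒪] 𝒪 := Finsupp.lapply 1 ∘ₗ (coeffLinearEquiv 𝒪).toLinearMap
  have hc : ∀ a : MonoidAlgebra 𝒪 G, ∑ g : G, c (single g⁻¹ 1 * a) • single g (1 : 𝒪) = a := by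
    intro a
    ext g
    simp [c, coeff_sum]
  refine ⟨Finsupp.linearCombination 𝒪 id ∘ₗ Finsupp.mapRange.linearMap c ∘ₗ
    s.restrictScalars 𝒪, fun x => ?_⟩
  have hy : ∀ y : Q →₀ MonoidAlgebra 𝒪 G,
      ∑ g : G, single g (1 : 𝒪) • Finsupp.linearCombination 𝒪 id
        (Finsupp.mapRange.linearMap c (single g⁻¹ (1 : 𝒪) • y)) =
      Finsupp.linearCombination (MonoidAlgebra 𝒪 G) id y := fun y => by
    induction y using Finsupp.induction_linear with
    | zero => simp
    | add y z hy hz => simp only [smul_add, map_add, Finset.sum_add_distrib, hy, hz]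
    | single q a =>
      conv_rhs => rw [← hc a]
      simp only [Finset.sum_smul, Finsupp.smul_single, smul_eq_mul,
        Finsupp.mapRange.linearMap_apply, Finsupp.mapRange_single,
        Finsupp.linearCombination_single, id_eq, smul_assoc, smul_comm _ (c _) q]
  simpa using (hy (s x)).trans (hs x)

open MonoidAlgebra in
/-- A lattice over a group ring of a finite group lifts along surjections with projective kernel. -/
theorem exists_lift_of_projective_ker [Finite G] {K P A : Type}
    [AddCommGroup K] [Module (MonoidAlgebra 𝒪 G) K] [Module 𝒪 K]
    [IsScalarTower 𝒪 (MonoidAlgebra 𝒪 G) K] [Module.Projective 𝒪 K]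
    [AddCommGroup P] [Module (MonoidAlgebra 𝒪 G) P] [Module 𝒪 P]
    [IsScalarTower 𝒪 (MonoidAlgebra 𝒪 G) P]
    [AddCommGroup A] [Module (MonoidAlgebra 𝒪 G) A] [Module 𝒪 A]
    [IsScalarTower 𝒪 (MonoidAlgebra 𝒪 G) A]
    (p : P →ₗ[MonoidAlgebra 𝒪 G] A) (hp : Function.Surjective p)
    [Module.Projective (MonoidAlgebra 𝒪 G) (LinearMap.ker p)]
    (f : K →ₗ[MonoidAlgebra 𝒪 G] A) :
    ∃ h : K →ₗ[MonoidAlgebra 𝒪 G] P, ∀ x, p (h x) = f x := by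
  cases nonempty_fintype G
  obtain ⟨θ, hθ⟩ := exists_sum_conj_eq_self (𝒪 := 𝒪) (G := G) (LinearMap.ker p)
  obtain ⟨l, hl⟩ := Module.projective_lifting_property (p.restrictScalars 𝒪)
    (f.restrictScalars 𝒪) hp
  replace hl : ∀ x, p (l x) = f x := fun x => LinearMap.congr_fun hl x
  let D (g : G) : K →ₗ[𝒪] LinearMap.ker p :=
    (DistribSMul.toLinearMap 𝒪 P (single g⁻¹ (1 : 𝒪)) ∘ₗ l -
      l ∘ₗ DistribSMul.toLinearMap 𝒪 K (single g⁻¹ (1 : 𝒪))).codRestrict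
        ((LinearMap.ker p).restrictScalars 𝒪) fun x => by simp [hl]
  have hD : ∀ g x, (D g x : P) = single g⁻¹ (1 : 𝒪) • l x - l (single g⁻¹ (1 : 𝒪) • x) :=
    fun _ _ => rfl
  let h : K →ₗ[𝒪] P := l - ∑ g : G, DistribSMul.toLinearMap 𝒪 P (single g (1 : 𝒪)) ∘ₗ
    (LinearMap.ker p).subtype.restrictScalars 𝒪 ∘ₗ θ ∘ₗ D g
  have h_apply : ∀ x, h x = l x - ∑ g : G, single g (1 : 𝒪) • (θ (D g x) : P) := fun x => by
    simp [h]
  refine ⟨equivariantOfLinearOfComm h fun k x => ?_, fun x => ?_⟩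
  · let w : LinearMap.ker p :=
      ⟨l (single k (1 : 𝒪) • x) - single k (1 : 𝒪) • l x, by simp [hl]⟩
    have hw : ∀ g, D g (single k (1 : 𝒪) • x) = D (k⁻¹ * g) x + single g⁻¹ (1 : 𝒪) • w := fun g => by
      ext
      simp [hD, w, smul_sub, smul_smul, single_mul_single]
    have hsum : single k (1 : 𝒪) • ∑ g : G, single g (1 : 𝒪) • (θ (D g x) : P) =
        ∑ g : G, single g (1 : 𝒪) • (θ (D (k⁻¹ * g) x) : P) := by
      rw [Finset.smul_sum]
      refine Fintype.sum_equiv (Equiv.mulLeft k) _ _ fun g => ?_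
      simp [smul_smul, single_mul_single]
    have hθw : ∑ g : G, single g (1 : 𝒪) • (θ (single g⁻¹ (1 : 𝒪) • w) : P) = w := by
      conv_rhs => rw [← hθ w]
      simp
    simp only [h_apply, smul_sub, hsum, hw, map_add, Submodule.coe_add, smul_add,
      Finset.sum_add_distrib, hθw]
    simp only [w]
    abel
  · simp [h_apply, hl]

theorem projective_of_tower {P : Type}
    [AddCommGroup P] [Module (MonoidAlgebra 𝒪 G) P] [Module 𝒪 P]
    [IsScalarTower 𝒪 (MonoidAlgebra 𝒪 G) P] [Module.Projective (MonoidAlgebra 𝒪 G) P] :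
    Module.Projective 𝒪 P := by
  obtain ⟨s, hs⟩ := Module.projective_def'.mp ‹Module.Projective (MonoidAlgebra 𝒪 G) P›
  exact Module.Projective.of_split (s.restrictScalars 𝒪)
    ((Finsupp.linearCombination (MonoidAlgebra 𝒪 G) id).restrictScalars 𝒪)
    (LinearMap.ext fun x => LinearMap.congr_fun hs x)

instance [Finite G] : Module.Finite 𝒪 (MonoidAlgebra 𝒪 G) :=
  Module.Finite.equiv (MonoidAlgebra.coeffLinearEquiv 𝒪).symm

theorem isNoetherianRing_monoidAlgebra [Finite G] [IsNoetherianRing 𝒪] :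
    IsNoetherianRing (MonoidAlgebra 𝒪 G) :=
  isNoetherian_of_tower 𝒪 inferInstance

theorem projective_submodule [Finite G] [IsDomain 𝒪] [IsPrincipalIdealRing 𝒪] {P : Type}
    [AddCommGroup P] [Module (MonoidAlgebra 𝒪 G) P] [Module 𝒪 P]
    [IsScalarTower 𝒪 (MonoidAlgebra 𝒪 G) P] [Module.Projective (MonoidAlgebra 𝒪 G) P]
    [Module.Finite (MonoidAlgebra 𝒪 G) P] (L : Submodule (MonoidAlgebra 𝒪 G) P) :
    Module.Projective 𝒪 L := by
  have := projective_of_tower (𝒪 := 𝒪) (G := G) (P := P)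
  have : Module.Finite 𝒪 P := Module.Finite.trans (MonoidAlgebra 𝒪 G) P
  have : Module.Finite 𝒪 L := Module.Finite.of_injective (L.subtype.restrictScalars 𝒪)
    L.injective_subtype
  have : Module.Free 𝒪 P := inferInstance
  have : Module.Free 𝒪 L := inferInstance
  infer_instance

end GroupRing

theorem isPrincipalIdealRing_of_isLocalization {A : Type} [CommRing A] [IsPrincipalIdealRing A]
    (S : Submonoid A) (B : Type) [CommRing B] [Algebra A B] [IsLocalization S B] :
    IsPrincipalIdealRing B where
  principal I := by
    rw [← IsLocalization.map_under S B I,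
      ← Ideal.span_singleton_generator (Ideal.under A I), Ideal.map_span,
      Set.image_singleton]
    exact ⟨_, rfl⟩

theorem IsAllowedBase.isDomain_and_isPrincipalIdealRing {𝒪 : Type} [CommRing 𝒪]
    (h : IsAllowedBase 𝒪) : IsDomain 𝒪 ∧ IsPrincipalIdealRing 𝒪 := by
  have transfer : ∀ (S : Type) [CommRing S] [IsDomain S] [IsPrincipalIdealRing S] (_ : 𝒪 ≃+* S),
      IsDomain 𝒪 ∧ IsPrincipalIdealRing 𝒪 := fun S _ _ _ e =>
    ⟨e.toMulEquiv.isDomain S, IsPrincipalIdealRing.of_surjective e.symm e.symm.surjective⟩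
  obtain ⟨⟨e⟩⟩ | ⟨⟨e⟩⟩ | ⟨p, hp, ⟨e⟩⟩ := h
  · exact transfer _ e
  · have hle : Submonoid.powers (2 : ℤ) ≤ nonZeroDivisors ℤ :=
      powers_le_nonZeroDivisors_of_noZeroDivisors two_ne_zero
    have := IsLocalization.isDomain_localization hle
    have := isPrincipalIdealRing_of_isLocalization (Submonoid.powers (2 : ℤ))
      (Localization.Away (2 : ℤ))
    exact transfer (Localization.Away (2 : ℤ)) e
  · have : Fact p.Prime := ⟨hp⟩
    exact transfer _ e

/-- Removing pieces of projective dimension at most one from the top and the bottom of a module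
over a group ring does not change its syzygy up to projective equivalence. -/
theorem projEquiv_ker_of_filtration {𝒪 G : Type} [CommRing 𝒪] [IsDomain 𝒪]
    [IsPrincipalIdealRing 𝒪] [Group G] [Finite G]
    {M P X F : Type} [AddCommGroup M] [Module (MonoidAlgebra 𝒪 G) M] [Finite M]
    [AddCommGroup P] [Module (MonoidAlgebra 𝒪 G) P] [Module.Finite (MonoidAlgebra 𝒪 G) P]
    [Module.Projective (MonoidAlgebra 𝒪 G) P]
    [AddCommGroup X] [Module (MonoidAlgebra 𝒪 G) X]
    [AddCommGroup F] [Module (MonoidAlgebra 𝒪 G) F] [Module.Finite (MonoidAlgebra 𝒪 G) F]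
    [Module.Projective (MonoidAlgebra 𝒪 G) F]
    (p : P →ₗ[MonoidAlgebra 𝒪 G] M) (hp : Function.Surjective p)
    (M' M'' : Submodule (MonoidAlgebra 𝒪 G) M) (hM : M' ≤ M'')
    (hM' : PdLeOne (MonoidAlgebra 𝒪 G) M') (hM'' : PdLeOne (MonoidAlgebra 𝒪 G) (M ⧸ M''))
    (e : (M'' ⧸ (M'.comap M''.subtype)) ≃ₗ[MonoidAlgebra 𝒪 G] X)
    (π : F →ₗ[MonoidAlgebra 𝒪 G] X) (hπ : Function.Surjective π) :
    ProjEquiv (MonoidAlgebra 𝒪 G) (LinearMap.ker π) (LinearMap.ker p) := by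
  have := isNoetherianRing_monoidAlgebra (𝒪 := 𝒪) (G := G)
  let Q : Submodule (MonoidAlgebra 𝒪 G) P := M''.comap p
  have hQker : LinearMap.ker (M''.mkQ ∘ₗ p) = Q := by
    rw [LinearMap.ker_comp, Submodule.ker_mkQ]
  have hQ : Module.Projective (MonoidAlgebra 𝒪 G) Q := by
    rw [← hQker]
    exact hM''.projective_ker _ (M''.mkQ_surjective.comp hp)
  let r : Q →ₗ[MonoidAlgebra 𝒪 G] M'' := p.restrict fun x hx => hx
  have hr : Function.Surjective r := fun ⟨m, hm⟩ => by
    obtain ⟨x, rfl⟩ := hp m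
    exact ⟨⟨x, hm⟩, rfl⟩
  let q : Q →ₗ[MonoidAlgebra 𝒪 G] X := e.toLinearMap ∘ₗ (M'.comap M''.subtype).mkQ ∘ₗ r
  have hq : Function.Surjective q :=
    e.surjective.comp ((Submodule.mkQ_surjective _).comp hr)
  have hmem : ∀ x : Q, x ∈ LinearMap.ker q ↔ p x ∈ M' := fun x => by
    simp [q, r]
  refine (projEquiv_ker_ker π q hπ hq).trans ?_
  let a : LinearMap.ker q →ₗ[MonoidAlgebra 𝒪 G] M' :=
    (p ∘ₗ Q.subtype ∘ₗ (LinearMap.ker q).subtype).codRestrict M' fun x => (hmem x).1 x.2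
  have ha : Function.Surjective a := fun ⟨m, hm⟩ => by
    obtain ⟨x, rfl⟩ := hp m
    exact ⟨⟨⟨x, hM hm⟩, (hmem _).2 hm⟩, rfl⟩
  let k : LinearMap.ker a ≃ₗ[MonoidAlgebra 𝒪 G] LinearMap.ker p :=
    LinearEquiv.ofBijective
      ((Q.subtype ∘ₗ (LinearMap.ker q).subtype ∘ₗ (LinearMap.ker a).subtype).codRestrict
        (LinearMap.ker p) fun x => congrArg Subtype.val x.2)
      ⟨fun x y hxy => Subtype.ext (Subtype.ext (Subtype.ext (congrArg (LinearMap.ker p).subtype hxy))),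
        fun ⟨x, hx⟩ => by
          have hx0 : p x = 0 := hx
          exact ⟨⟨⟨⟨x, by simp [Q, hx0]⟩, (hmem _).2 (by simp [hx0])⟩, Subtype.ext hx0⟩, rfl⟩⟩
  have : Module.Finite (MonoidAlgebra 𝒪 G) M' := Module.Finite.of_finite
  obtain ⟨n, b, hb⟩ := Module.Finite.exists_fin' (MonoidAlgebra 𝒪 G) M'
  have hbker := hM'.projective_ker b hb
  let : Module 𝒪 P := Module.compHom P (algebraMap 𝒪 (MonoidAlgebra 𝒪 G))
  have : IsScalarTower 𝒪 (MonoidAlgebra 𝒪 G) P :=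
    ⟨fun x y z => by rw [Algebra.smul_def, mul_smul]; rfl⟩
  let : Module 𝒪 M := Module.compHom M (algebraMap 𝒪 (MonoidAlgebra 𝒪 G))
  have : IsScalarTower 𝒪 (MonoidAlgebra 𝒪 G) M :=
    ⟨fun x y z => by rw [Algebra.smul_def, mul_smul]; rfl⟩
  have := projective_submodule (𝒪 := 𝒪) (LinearMap.ker q)
  obtain ⟨h, hh⟩ := exists_lift_of_projective_ker (𝒪 := 𝒪) (K := LinearMap.ker q) b hb a
  obtain ⟨h', hh'⟩ := Module.projective_lifting_property a b ha
  refine ⟨Fin n → MonoidAlgebra 𝒪 G, inferInstance, inferInstance, LinearMap.ker b,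
    inferInstance, inferInstance, inferInstance, inferInstance, inferInstance, hbker, ⟨?_⟩⟩
  exact LinearEquiv.prodComm _ _ _ ≪≫ₗ
    LinearMap.kerProdEquivOfFactor b a h h' hh (fun x => LinearMap.congr_fun hh' x) ≪≫ₗ
    k.prodCongr (LinearEquiv.refl _ _)

/-- If `X ∼ Y` are finite modules over `R = 𝒪[Γ₀]` and `0 → K → F → X → 0`,
`0 → K' → F' → Y → 0` are short exact sequences with `F`, `F'` finitely generated
projective, then the lattices `K` and `K'` are projectively equivalent. -/
theorem syzygy_lattice_well_defined
    (𝒪 : Type) [CommRing 𝒪] (h𝒪 : IsAllowedBase 𝒪)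
    (Γ₀ : Type) [Group Γ₀] [Finite Γ₀]
    (X : Type) [AddCommGroup X] [Module (MonoidAlgebra 𝒪 Γ₀) X] [Finite X]
    (Y : Type) [AddCommGroup Y] [Module (MonoidAlgebra 𝒪 Γ₀) Y] [Finite Y]
    (hXY : ModEquiv (MonoidAlgebra 𝒪 Γ₀) X Y)
    (K : Type) [AddCommGroup K] [Module (MonoidAlgebra 𝒪 Γ₀) K]
    (F : Type) [AddCommGroup F] [Module (MonoidAlgebra 𝒪 Γ₀) F]
    (K' : Type) [AddCommGroup K'] [Module (MonoidAlgebra 𝒪 Γ₀) K']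
    (F' : Type) [AddCommGroup F'] [Module (MonoidAlgebra 𝒪 Γ₀) F']
    (hF : Module.Finite (MonoidAlgebra 𝒪 Γ₀) F)
    (hFproj : Module.Projective (MonoidAlgebra 𝒪 Γ₀) F)
    (hF' : Module.Finite (MonoidAlgebra 𝒪 Γ₀) F')
    (hF'proj : Module.Projective (MonoidAlgebra 𝒪 Γ₀) F')
    (i : K →ₗ[MonoidAlgebra 𝒪 Γ₀] F) (π : F →ₗ[MonoidAlgebra 𝒪 Γ₀] X)
    (i' : K' →ₗ[MonoidAlgebra 𝒪 Γ₀] F') (π' : F' →ₗ[MonoidAlgebra 𝒪 Γ₀] Y)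
    (hi : Function.Injective i) (hπ : Function.Surjective π)
    (hexact : LinearMap.range i = LinearMap.ker π)
    (hi' : Function.Injective i') (hπ' : Function.Surjective π')
    (hexact' : LinearMap.range i' = LinearMap.ker π') :
    ProjEquiv (MonoidAlgebra 𝒪 Γ₀) K K' := by
  obtain ⟨_, _⟩ := h𝒪.isDomain_and_isPrincipalIdealRing
  obtain ⟨M, _, _, N, _, _, _, _, ⟨e⟩, M', M'', N', N'', hM, hN, hM', hN', hM'', hN'',
    ⟨eX⟩, ⟨eY⟩⟩ := hXY
  have : Module.Finite (MonoidAlgebra 𝒪 Γ₀) M := Module.Finite.of_finite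
  obtain ⟨n, p, hp⟩ := Module.Finite.exists_fin' (MonoidAlgebra 𝒪 Γ₀) M
  have h₁ := projEquiv_ker_of_filtration p hp M' M'' hM hM' hM'' eX π hπ
  have h₂ := projEquiv_ker_of_filtration (e.toLinearMap ∘ₗ p) (e.surjective.comp hp)
    N' N'' hN hN' hN'' eY π' hπ'
  rw [LinearEquiv.ker_comp] at h₂
  have hK := ProjEquiv.of_linearEquiv
    (LinearEquiv.ofInjective i hi ≪≫ₗ LinearEquiv.ofEq _ _ hexact)
  have hK' := ProjEquiv.of_linearEquiv
    (LinearEquiv.ofInjective i' hi' ≪≫ₗ LinearEquiv.ofEq _ _ hexact')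
  exact hK.trans (h₁.trans (h₂.symm.trans hK'.symm))
end

section
/- Let p be an odd prime, Γ a finite group, and G = Γ × ⟨j⟩ with j an element of exact order 2. Let D be a subgroup of G and I a normal subgroup of D with D/I cyclic generated by φ. Assume p ∣ #I and j ∈ D. Then the finite left ℤ_p[G]-module A = ℤ_p[G] ⊗_{ℤ_p[D]} (ℤ_p[D/I]/(g_φ)) satisfies A/(1+j)A = 0; that is, the minus part of A with respect to j vanishes. -/
/-- The left ideal of `ℤ_p[G]` generated by the image of the kernel of
`ℤ_p[D] → ℤ_p[D/I]/(g_φ)`, where `g_φ = 1 − φ⁻¹ + #I`.  The quotient of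
`ℤ_p[G]` by this left ideal realizes the induced module
`A = ℤ_p[G] ⊗_{ℤ_p[D]} (ℤ_p[D/I]/(g_φ))`, since `ℤ_p[G]` is free over `ℤ_p[D]`. -/
noncomputable def relationIdealP (p : ℕ) [Fact p.Prime] (G : Type) [Group G] [Finite G]
    (D I : Subgroup G) (hID : I ≤ D) [(I.subgroupOf D).Normal]
    (φ : ↥D ⧸ I.subgroupOf D) :
    Submodule (MonoidAlgebra ℤ_[p] G) (MonoidAlgebra ℤ_[p] G) :=
  Submodule.span (MonoidAlgebra ℤ_[p] G)
    ((MonoidAlgebra.mapDomainRingHom ℤ_[p] D.subtype) ''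
      {x : MonoidAlgebra ℤ_[p] ↥D |
        MonoidAlgebra.mapDomainRingHom ℤ_[p] (QuotientGroup.mk' (I.subgroupOf D)) x ∈
          Ideal.span {1 - MonoidAlgebra.of ℤ_[p] (↥D ⧸ I.subgroupOf D) φ⁻¹ +
            (Nat.card I : MonoidAlgebra ℤ_[p] (↥D ⧸ I.subgroupOf D))}})

theorem mapDomainRingHom_of {R M N : Type*} [Semiring R] [Monoid M] [Monoid N]
    (f : M →* N) (m : M) :
    MonoidAlgebra.mapDomainRingHom R f (MonoidAlgebra.of R M m) = MonoidAlgebra.of R N (f m) :=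
  MonoidAlgebra.mapDomain_single

theorem mapDomainRingHom_surjective {R M N : Type*} [Semiring R] [Monoid M] [Monoid N]
    {f : M →* N} (hf : Function.Surjective f) :
    Function.Surjective (MonoidAlgebra.mapDomainRingHom R f) := fun x => by
  obtain ⟨y, hy⟩ := Finsupp.mapDomain_surjective hf x.coeff
  exact ⟨.ofCoeff y, MonoidAlgebra.ext hy⟩

/-- If an odd prime `p` divides `N`, then `1 - ψ + N` and `1 + ψ ^ n`
generate the unit left ideal of any finite `ℤ_p`-algebra. -/
theorem span_sup_span_one_add_pow_eq_top {p : ℕ} [hp : Fact p.Prime] (hodd : Odd p)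
    {R : Type*} [Ring R] [Algebra ℤ_[p] R] [Module.Finite ℤ_[p] R]
    (ψ : R) (n : ℕ) {N : ℕ} (hN : p ∣ N) :
    Ideal.span {1 - ψ + (N : R)} ⊔ Ideal.span {1 + ψ ^ n} = ⊤ := by
  set J : Ideal R := Ideal.span {1 - ψ + (N : R)} ⊔ Ideal.span {1 + ψ ^ n}
  obtain ⟨c, rfl⟩ := hN
  obtain ⟨k, hk⟩ := hodd
  have hg : 1 - ψ + ((p * c : ℕ) : R) ∈ J :=
    Ideal.mem_sup_left (Ideal.subset_span rfl)
  have hι : 1 + ψ ^ n ∈ J := Ideal.mem_sup_right (Ideal.subset_span rfl)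
  have key : (⊤ : Submodule ℤ_[p] R) ≤ J.restrictScalars ℤ_[p] := by
    refine Submodule.le_of_le_smul_of_le_jacobson_bot (I := Ideal.span {(p : ℤ_[p])})
      Module.Finite.fg_top ?_ ?_
    · rw [IsLocalRing.jacobson_eq_maximalIdeal _ bot_ne_top, ← PadicInt.maximalIdeal_eq_span_p]
    · intro r _
      set s : R := ∑ i ∈ Finset.range n, ψ ^ i
      have hgeom : s * (ψ - 1) = ψ ^ n - 1 := geom_sum_mul ψ n
      have hr : r = -(k : R) * (r * (1 + ψ ^ n) + r * s * (1 - ψ + ((p * c : ℕ) : R)))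
          + (p : ℤ_[p]) • (r + (k : R) * (r * s * (c : R))) := by
        have h1 : r * s * (1 - ψ) = r * (1 - ψ ^ n) := by
          rw [mul_assoc, ← neg_sub ψ 1, mul_neg, hgeom, neg_sub]
        have h2 : r * s * ((p * c : ℕ) : R) = (p : R) * (r * s * (c : R)) := by
          rw [Nat.cast_mul, ← mul_assoc, ← (Nat.cast_commute p (r * s)).eq, mul_assoc]
        have h3 : (p : R) = 2 * (k : R) + 1 := by rw [hk]; push_cast; rfl
        rw [mul_add (r * s), h1, h2, Algebra.smul_def, map_natCast, h3]
        noncomm_ring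
      rw [hr]
      refine Submodule.add_mem_sup ?_ (Submodule.smul_mem_smul (Ideal.subset_span rfl) trivial)
      exact J.mul_mem_left _ (J.add_mem (J.mul_mem_left _ hι) (J.mul_mem_left _ hg))
  exact (Ideal.eq_top_iff_one J).2 (key trivial)

/-- Let `p` be an odd prime, `Γ` a finite group and `G = Γ × ⟨j⟩` with `j` of
exact order `2`.  If `I ⊴ D ≤ G` with `D/I` cyclic generated by `φ`, `p ∣ #I`
and `j ∈ D`, then the minus part of
`A = ℤ_p[G] ⊗_{ℤ_p[D]} (ℤ_p[D/I]/(g_φ))` vanishes: `A = (1+j)A`,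
i.e. `A/(1+j)A = 0`. -/
theorem minus_part_vanishes (p : ℕ) [Fact p.Prime] (hodd : Odd p)
    (Γ : Type) [Group Γ] [Finite Γ]
    (D I : Subgroup (Γ × Multiplicative (ZMod 2))) (hID : I ≤ D)
    [(I.subgroupOf D).Normal]
    (φ : ↥D ⧸ I.subgroupOf D)
    (hφ : ∀ x : ↥D ⧸ I.subgroupOf D, x ∈ Subgroup.zpowers φ)
    (hpI : p ∣ Nat.card I)
    (hjD : ((1 : Γ), Multiplicative.ofAdd (1 : ZMod 2)) ∈ D) :
    ∀ a : (MonoidAlgebra ℤ_[p] (Γ × Multiplicative (ZMod 2)) ⧸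
        relationIdealP p (Γ × Multiplicative (ZMod 2)) D I hID φ),
      ∃ b, a = ((1 : MonoidAlgebra ℤ_[p] (Γ × Multiplicative (ZMod 2))) +
          MonoidAlgebra.of ℤ_[p] (Γ × Multiplicative (ZMod 2))
            ((1 : Γ), Multiplicative.ofAdd (1 : ZMod 2))) • b := by
  intro a
  obtain ⟨α, rfl⟩ := Submodule.Quotient.mk_surjective _ a
  set j : Γ × Multiplicative (ZMod 2) := (1, Multiplicative.ofAdd 1) with hj
  set π := QuotientGroup.mk' (I.subgroupOf D)
  obtain ⟨n, hn⟩ : ∃ n : ℕ, φ⁻¹ ^ n = π ⟨j, hjD⟩ := by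
    have h := hφ (π ⟨j, hjD⟩)
    rwa [← Subgroup.zpowers_inv, ← mem_powers_iff_mem_zpowers] at h
  have htop := span_sup_span_one_add_pow_eq_top hodd
    (MonoidAlgebra.of ℤ_[p] (↥D ⧸ I.subgroupOf D) φ⁻¹) n hpI
  rw [← map_pow, hn] at htop
  obtain ⟨x, hx, y, hy, hxy⟩ := Submodule.mem_sup.1 (htop ▸ Submodule.mem_top :
    (1 : MonoidAlgebra ℤ_[p] (↥D ⧸ I.subgroupOf D)) ∈ _)
  obtain ⟨b, rfl⟩ := Ideal.mem_span_singleton'.1 hy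
  obtain ⟨b, rfl⟩ : ∃ c, MonoidAlgebra.mapDomainRingHom ℤ_[p] π c = b :=
    mapDomainRingHom_surjective (QuotientGroup.mk'_surjective _) b
  set B := MonoidAlgebra.mapDomainRingHom ℤ_[p] D.subtype b
  have hmem : 1 - B * (1 + MonoidAlgebra.of ℤ_[p] _ j) ∈
      relationIdealP p (Γ × Multiplicative (ZMod 2)) D I hID φ := by
    refine Submodule.subset_span ⟨1 - b * (1 + MonoidAlgebra.of ℤ_[p] D ⟨j, hjD⟩), ?_, ?_⟩
    · rw [Set.mem_ofPred_eq]
      convert hx using 1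
      rw [← eq_sub_iff_add_eq] at hxy
      rw [hxy, map_sub, map_mul, map_add, map_one, mapDomainRingHom_of]
    · rw [map_sub, map_mul, map_add, map_one, mapDomainRingHom_of, Subgroup.subtype_apply]
  have hcomm : Commute (MonoidAlgebra.of ℤ_[p] _ j) (α * B) := by
    refine MonoidAlgebra.of_commute (fun g => ?_) (α * B)
    exact Prod.ext (by simp [hj]) (mul_comm _ _)
  refine ⟨Submodule.Quotient.mk (α * B), ?_⟩
  rw [← Submodule.Quotient.mk_smul, Submodule.Quotient.eq, smul_eq_mul,
    ((Commute.one_left _).add_left hcomm).eq, mul_assoc]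
  simpa [mul_sub] using Submodule.smul_mem _ α hmem
end

section
/- Let n ≥ 1, let ℓ_1, …, ℓ_n be prime numbers, and for each i let K_i be a finite field extension of the field ℚ_{ℓ_i} of ℓ_i-adic numbers. Then there exist a totally real number field K and distinct finite places v_1, …, v_n of K, with v_i lying above ℓ_i, such that for each i the completion of K at v_i is isomorphic to K_i as a ℚ_{ℓ_i}-algebra. -/
open IsDedekindDomain

/-- A finite field extension of `ℚ_ℓ`, bundled. -/
structure LocalFieldExt (ℓ : ℕ) [Fact ℓ.Prime] where
  carrier : Type
  [field : Field carrier]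
  [algebra : Algebra ℚ_[ℓ] carrier]
  [finiteDimensional : FiniteDimensional ℚ_[ℓ] carrier]

instance (ℓ : ℕ) [Fact ℓ.Prime] (L : LocalFieldExt ℓ) : Field L.carrier := L.field
instance (ℓ : ℕ) [Fact ℓ.Prime] (L : LocalFieldExt ℓ) : Algebra ℚ_[ℓ] L.carrier :=
  L.algebra
instance (ℓ : ℕ) [Fact ℓ.Prime] (L : LocalFieldExt ℓ) :
    FiniteDimensional ℚ_[ℓ] L.carrier := L.finiteDimensional

section

open Polynomial Filter Topology

theorem Polynomial.exists_root_near {L : Type*} [NontriviallyNormedField L] [CompleteSpace L]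
    {P : L[X]} {d : ℕ} (hP : P.natDegree ≤ d) {b : L} (hb : P.eval b = 0)
    (hb' : P.derivative.eval b ≠ 0) {U : Set L} (hU : U ∈ 𝓝 b) :
    ∃ ε > 0, ∀ Q : L[X], Q.natDegree ≤ d → (∀ j, ‖Q.coeff j - P.coeff j‖ < ε) →
      ∃ r ∈ U, Q.eval r = 0 := by
  let F : (Fin (d + 1) → L) × L → L := fun z => ∑ j : Fin (d + 1), z.1 j * z.2 ^ (j : ℕ)
  have hF : ∀ Q : L[X], Q.natDegree ≤ d → ∀ x, F (fun j => Q.coeff j, x) = Q.eval x := by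
    intro Q hQ x
    rw [eval_eq_sum_range' (Nat.lt_succ_of_le hQ), Finset.sum_range]
  let a : Fin (d + 1) → L := fun j => P.coeff j
  have hFd : AnalyticAt L F (a, b) :=
    Finset.univ.analyticAt_fun_sum fun j _ =>
      ((ContinuousLinearMap.proj (R := L) (φ := fun _ => L) j ∘L .fst L _ L).analyticAt _).mul
        (analyticAt_snd.pow _)
  have hs : HasStrictFDerivAt F (fderiv L F (a, b)) (a, b) :=
    hFd.hasStrictFDerivAt
  have hpart : HasDerivAt (fun x => F (a, x))
      ((fderiv L F (a, b) ∘L .inr L (Fin (d + 1) → L) L) 1) b :=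
    (hs.hasFDerivAt.comp b (hasFDerivAt_prodMk_right a b)).hasDerivAt
  have hval : (fderiv L F (a, b) ∘L .inr L (Fin (d + 1) → L) L) 1 = P.derivative.eval b := by
    refine hpart.unique ?_
    simp only [a, hF P hP]
    exact P.hasDerivAt b
  have hinv : (fderiv L F (a, b) ∘L .inr L (Fin (d + 1) → L) L).IsInvertible := by
    refine ⟨ContinuousLinearEquiv.unitsEquivAut L (Units.mk0 _ hb'), ?_⟩
    ext
    simp [← hval]
  have h0 : F (a, b) = 0 := by rw [hF P hP, hb]
  have h1 := hs.eventually_apply_implicitFunctionOfProdDomain hinv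
  have h2 := (hs.tendsto_implicitFunctionOfProdDomain hinv).eventually hU
  obtain ⟨ε, hε, h⟩ := Metric.eventually_nhds_iff.1 (h1.and h2)
  refine ⟨ε, hε, fun Q hQ hQP => ?_⟩
  have hd : dist (fun j : Fin (d + 1) => Q.coeff j) a < ε :=
    (dist_pi_lt_iff hε).2 fun j => by simpa [dist_eq_norm] using hQP j
  obtain ⟨h3, h4⟩ := h hd
  exact ⟨_, h4, by rw [← hF Q hQ, h3, h0]⟩

theorem eventually_adjoin_eq_top {k L : Type*} [NontriviallyNormedField k] [CompleteSpace k]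
    [NormedField L] [NormedAlgebra k L] [FiniteDimensional k L] {b : L}
    (hb : Algebra.adjoin k {b} = ⊤) :
    ∀ᶠ r in 𝓝 b, Algebra.adjoin k {r} = ⊤ := by
  let φ : L → Fin (Module.finrank k L) → L := fun x i => x ^ (i : ℕ)
  have hφ : Continuous φ := by fun_prop
  have hbt : IntermediateField.adjoin k {b} = ⊤ := by
    rw [← top_le_iff, ← IntermediateField.toSubalgebra_le_toSubalgebra,
      IntermediateField.top_toSubalgebra, ← hb]
    exact IntermediateField.algebra_adjoin_le_adjoin k _
  have hdeg := (IntermediateField.adjoin.finrank (Algebra.IsIntegral.isIntegral (R := k) b)).symm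
  rw [hbt, IntermediateField.finrank_top'] at hdeg
  have hli : LinearIndependent k (φ b) := by
    have := linearIndependent_pow (K := k) b
    rw [hdeg] at this
    exact this
  filter_upwards [(isOpen_setOfPred_linearIndependent.preimage hφ).mem_nhds hli] with r hr
  have hs := LinearIndependent.span_eq_top_of_card_eq_finrank' hr (by simp)
  rw [← Algebra.toSubmodule_eq_top, ← top_le_iff, ← hs, Submodule.span_le]
  rintro _ ⟨i, rfl⟩
  exact pow_mem (Algebra.self_mem_adjoin_singleton k r) _

theorem exists_isIntegral_adjoin_eq_top (p : ℕ) [Fact p.Prime] {L : Type*}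
    [NontriviallyNormedField L] [NormedAlgebra ℚ_[p] L] [FiniteDimensional ℚ_[p] L] :
    ∃ b : L, IsIntegral ℤ b ∧ Algebra.adjoin ℚ_[p] {b} = ⊤ := by
  have : CompleteSpace L := FiniteDimensional.complete ℚ_[p] L
  have : CharZero L := charZero_of_injective_algebraMap (algebraMap ℚ_[p] L).injective
  obtain ⟨α, hα⟩ := Field.exists_primitive_element ℚ_[p] L
  have hαi : IsIntegral ℚ_[p] α := Algebra.IsIntegral.isIntegral α
  replace hα : Algebra.adjoin ℚ_[p] {α} = ⊤ := by
    rw [← IntermediateField.adjoin_simple_toSubalgebra_of_isAlgebraic hαi.isAlgebraic, hα,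
      IntermediateField.top_toSubalgebra]
  set m := minpoly ℚ_[p] α
  have hroot : (m.map (algebraMap ℚ_[p] L)).eval α = 0 := by simp [m]
  have hroot' : (m.map (algebraMap ℚ_[p] L)).derivative.eval α ≠ 0 := by
    rw [derivative_map, eval_map_algebraMap]
    exact (minpoly.irreducible hαi).separable.aeval_derivative_ne_zero (minpoly.aeval _ _)
  obtain ⟨ε, hε, h⟩ := exists_root_near natDegree_map_le hroot hroot'
    (eventually_adjoin_eq_top hα)
  choose q hq using fun j => Padic.rat_dense p (m.coeff j) hε
  let Q : ℚ[X] := X ^ m.natDegree + ∑ j ∈ Finset.range m.natDegree, C (q j) * X ^ j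
  have hQc : ∀ j, Q.coeff j = if j < m.natDegree then q j else
      if j = m.natDegree then 1 else 0 := by
    intro j
    simp only [Q, coeff_add, coeff_X_pow, finsetSum_coeff, coeff_C_mul, mul_ite, mul_one,
      mul_zero, Finset.sum_ite_eq, Finset.mem_range]
    split_ifs <;> first | omega | simp
  have hQ0 : Q ≠ 0 := fun h0 => by simpa [h0] using hQc m.natDegree
  have hQd : Q.natDegree ≤ m.natDegree := natDegree_le_iff_coeff_eq_zero.2 fun j hj => by
    rw [hQc, if_neg (by omega), if_neg (by omega)]
  obtain ⟨r, hr, hr0⟩ := h (Q.map (algebraMap ℚ L)) (natDegree_map_le.trans hQd) fun j => by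
    rw [coeff_map, coeff_map, hQc]
    split_ifs with h1 h2
    · have : algebraMap ℚ L (q j) = algebraMap ℚ_[p] L (q j) := by simp
      rw [this, ← map_sub, norm_algebraMap', norm_sub_rev]
      exact hq j
    · have hm : m.coeff m.natDegree = 1 := (minpoly.monic hαi).coeff_natDegree
      simpa [h2, hm] using hε
    · rw [coeff_eq_zero_of_natDegree_lt (by omega)]
      simpa using hε
  have halg : IsAlgebraic ℤ r := by
    rw [IsFractionRing.isAlgebraic_iff ℤ ℚ L]
    exact ⟨Q, hQ0, by rwa [← eval_map_algebraMap]⟩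
  obtain ⟨c, hc, hcr⟩ := halg.exists_integral_multiple
  refine ⟨c • r, hcr, ?_⟩
  rw [← top_le_iff, ← show Algebra.adjoin ℚ_[p] {r} = ⊤ from hr, Algebra.adjoin_le_iff,
    Set.singleton_subset_iff]
  have hcp : (c : ℚ_[p]) ≠ 0 := by exact_mod_cast hc
  have : r = (c : ℚ_[p])⁻¹ • (c • r) := by
    rw [← Int.cast_smul_eq_zsmul ℚ_[p], inv_smul_smul₀ hcp]
  have hmem := Subalgebra.smul_mem _ (Algebra.self_mem_adjoin_singleton ℚ_[p] (c • r))
    (c : ℚ_[p])⁻¹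
  rwa [← this] at hmem

theorem exists_isIntegral_adjoin_eq_top_near (p : ℕ) [Fact p.Prime] {L : Type*}
    [NontriviallyNormedField L] [NormedAlgebra ℚ_[p] L] [FiniteDimensional ℚ_[p] L] (i N : ℕ) :
    ∃ b c : L, IsIntegral ℤ c ∧ b = i + p ^ N * c ∧ Algebra.adjoin ℚ_[p] {b} = ⊤ := by
  obtain ⟨c, hc, hct⟩ := exists_isIntegral_adjoin_eq_top p (L := L)
  refine ⟨i + p ^ N * c, c, hc, rfl, ?_⟩
  rw [← top_le_iff, ← hct, Algebra.adjoin_le_iff, Set.singleton_subset_iff]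
  have hp : (p : L) ≠ 0 := by
    have : CharZero L := charZero_of_injective_algebraMap (algebraMap ℚ_[p] L).injective
    exact_mod_cast (Fact.out : p.Prime).ne_zero
  have hpp : (p : ℚ_[p]) ≠ 0 := by exact_mod_cast (Fact.out : p.Prime).ne_zero
  have : c = ((p : ℚ_[p]) ^ N)⁻¹ • ((i + p ^ N * c) - i) := by
    rw [Algebra.smul_def]
    simp [hp]
  have hmem := Subalgebra.smul_mem _ (Subalgebra.sub_mem _
    (Algebra.self_mem_adjoin_singleton ℚ_[p] ((i : L) + p ^ N * c))
    (natCast_mem (Algebra.adjoin ℚ_[p] {(i : L) + p ^ N * c}) i)) ((p : ℚ_[p]) ^ N)⁻¹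
  rwa [← this] at hmem

theorem Polynomial.exists_monic_common_simple_roots {ι : Type*} [Fintype ι] [Nonempty ι]
    {L : ι → Type*} [∀ i, Field (L i)] [∀ i, CharZero (L i)] {b : ∀ i, L i}
    (hb : ∀ i, IsIntegral ℤ (b i)) :
    ∃ P : ℤ[X], P.Monic ∧ 0 < P.natDegree ∧ ∀ i, aeval (b i) P = 0 ∧
      aeval (b i) P.derivative ≠ 0 := by
  classical
  let S : Finset ℤ[X] := Finset.univ.image fun i => minpoly ℤ (b i)
  have hS : ∀ h ∈ S, h.Monic ∧ Irreducible (h.map (algebraMap ℤ ℚ)) := by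
    intro h hh
    obtain ⟨i, -, rfl⟩ := Finset.mem_image.1 hh
    refine ⟨minpoly.monic (hb i), ?_⟩
    rw [← minpoly.isIntegrallyClosed_eq_field_fractions' ℚ (hb i)]
    exact minpoly.irreducible (hb i).tower_top
  have hmonic : (∏ h ∈ S, h).Monic := monic_prod_of_monic _ _ fun h hh => (hS h hh).1
  have hsep : ((∏ h ∈ S, h).map (algebraMap ℤ ℚ)).Separable := by
    rw [Polynomial.map_prod]
    refine separable_prod' (fun x hx y hy hxy => ?_) fun x hx => (hS x hx).2.separable
    refine (hS x hx).2.coprime_iff_not_dvd.2 fun hdvd => hxy ?_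
    have := eq_of_monic_of_associated ((hS x hx).1.map _) ((hS y hy).1.map _)
      ((hS x hx).2.associated_of_dvd (hS y hy).2 hdvd)
    exact map_injective _ (algebraMap ℤ ℚ).injective_int this
  have hroot : ∀ i, aeval (b i) (∏ h ∈ S, h) = 0 := fun i => by
    rw [map_prod]
    exact Finset.prod_eq_zero (Finset.mem_image_of_mem _ (Finset.mem_univ i)) (minpoly.aeval _ _)
  refine ⟨_, hmonic, ?_, fun i => ⟨hroot i, ?_⟩⟩
  · by_contra h0
    have h1 := hmonic.natDegree_eq_zero.1 (by omega)
    simpa [h1] using hroot (Classical.arbitrary ι)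
  · have := hsep.aeval_derivative_ne_zero (x := b i) (by rw [aeval_map_algebraMap, hroot])
    rwa [derivative_map, aeval_map_algebraMap] at this

theorem Polynomial.exists_roots_of_alternating_signs {f : ℝ[X]} {d : ℕ} {c : ℕ → ℝ}
    (hc : StrictMono c) (hf : ∀ k < d, f.eval (c k) * f.eval (c (k + 1)) < 0) :
    ∃ s : Finset ℝ, s.card = d ∧ ∀ x ∈ s, f.eval x = 0 := by
  have h : ∀ k : Fin d, ∃ x ∈ Set.Ioo (c k) (c (k + 1)), f.eval x = 0 := by
    intro k
    have hlt : c k < c (k + 1) := hc (Nat.lt_succ_self _)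
    have hcont : ContinuousOn (fun x => f.eval x) (Set.Icc (c k) (c (k + 1))) :=
      f.continuous.continuousOn
    rcases mul_neg_iff.1 (hf k k.2) with ⟨h1, h2⟩ | ⟨h1, h2⟩
    · exact intermediate_value_Ioo' hlt.le hcont ⟨h2, h1⟩
    · exact intermediate_value_Ioo hlt.le hcont ⟨h1, h2⟩
  choose x hx hx0 using h
  have hmono : StrictMono x := fun i j hij =>
    (hx i).2.trans_le ((hc.monotone (Nat.succ_le_of_lt hij)).trans (hx j).1.le)
  exact ⟨Finset.univ.map ⟨x, hmono.injective⟩, by simp, by simpa using hx0⟩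

/-- At half-integers, `∏ (X - k)` is bounded away from zero with alternating signs. -/
theorem half_pow_le_neg_one_pow_mul_prod {d k : ℕ} (hk : k ≤ d) :
    (1 / 2 : ℝ) ^ d ≤ (-1) ^ (d - k) * ∏ j ∈ Finset.range d, ((k : ℝ) + 1 / 2 - (j + 1)) := by
  induction d, hk using Nat.le_induction with
  | base =>
    rw [Nat.sub_self, pow_zero, one_mul]
    have := Finset.prod_le_prod (s := Finset.range k) (f := fun _ => (1 / 2 : ℝ))
      (g := fun j : ℕ => (k : ℝ) + 1 / 2 - (j + 1)) (fun _ _ => by norm_num) fun j hj => by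
        have : (j : ℝ) + 1 ≤ k := by exact_mod_cast Finset.mem_range.1 hj
        linarith
    simpa only [Finset.prod_const, Finset.card_range] using this
  | succ d hkd ih =>
    have hkd' : (k : ℝ) ≤ d := by exact_mod_cast hkd
    rw [Nat.succ_sub hkd, pow_succ, pow_succ, Finset.prod_range_succ]
    calc (1 / 2 : ℝ) ^ d * (1 / 2)
        ≤ ((-1) ^ (d - k) * ∏ j ∈ Finset.range d, ((k : ℝ) + 1 / 2 - (j + 1))) *
          (d + 1 / 2 - k) := by
          refine mul_le_mul ih (by linarith) (by norm_num) (le_trans (by positivity) ih)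
      _ = _ := by ring

theorem Polynomial.C_dvd_prod_X_sub_C_sub_X_pow {R : Type*} [CommRing R] (T : R) (d : ℕ) :
    C T ∣ ∏ k ∈ Finset.range d, (X - C (T * (k + 1))) - X ^ d := by
  induction d with
  | zero => simp
  | succ d ih =>
    rw [Finset.prod_range_succ, pow_succ]
    have : (∏ k ∈ Finset.range d, (X - C (T * (k + 1)))) * (X - C (T * (d + 1))) - X ^ d * X =
        (∏ k ∈ Finset.range d, (X - C (T * (k + 1))) - X ^ d) * X -
          C T * (C (d + 1 : R) * ∏ k ∈ Finset.range d, (X - C (T * (k + 1)))) := by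
      rw [C_mul (a := T) (b := (d : R) + 1)]
      ring
    rw [this]
    exact dvd_sub (ih.mul_right _) (dvd_mul_right _ _)

theorem Polynomial.eventually_im_eq_zero_of_root {e : ℤ[X]} {d : ℕ} (he : e.degree < d) :
    ∀ᶠ T : ℤ in atTop, ∀ z : ℂ,
      aeval z (∏ k ∈ Finset.range d, (X - C (T * (k + 1))) + e) = 0 → z.im = 0 := by
  have hcast : Tendsto (fun T : ℤ => (T : ℝ)) atTop atTop := tendsto_intCast_atTop_atTop
  have hsmall : ∀ k ∈ Finset.range (d + 1), ∀ᶠ T : ℤ in atTop,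
      |aeval ((T : ℝ) * (k + 1 / 2)) e| < (T : ℝ) ^ d * (1 / 2) ^ d := by
    intro k _
    have hk : (0 : ℝ) < k + 1 / 2 := by positivity
    have h1 := div_tendsto_atTop_zero_of_degree_lt (e.map (Int.castRingHom ℝ)) (X ^ d : ℝ[X])
      (by rw [degree_X_pow]; exact degree_map_le.trans_lt he)
    have h2 := (h1.comp (hcast.atTop_mul_const hk)).norm
    rw [norm_zero] at h2
    have hpos : (0 : ℝ) < (1 / 2) ^ d / (k + 1 / 2) ^ d := by positivity
    filter_upwards [h2.eventually_lt_const hpos, eventually_gt_atTop 0] with T hT hT0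
    have hT0' : (0 : ℝ) < T := by exact_mod_cast hT0
    simp only [Function.comp_apply, eval_map, eval_pow, eval_X, norm_div, mul_pow,
      Real.norm_eq_abs, abs_mul, abs_pow, abs_of_pos hT0', abs_of_pos hk] at hT
    rw [div_lt_div_iff₀ (by positivity) (by positivity)] at hT
    rw [aeval_def, algebraMap_int_eq]
    refine lt_of_mul_lt_mul_right (hT.trans_eq ?_) (pow_nonneg hk.le d)
    ring
  filter_upwards [(Filter.eventually_all_finset _).2 hsmall, eventually_gt_atTop 0]
    with T hT hT0 z hz
  have hT0' : (0 : ℝ) < T := by exact_mod_cast hT0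
  set f : ℤ[X] := ∏ k ∈ Finset.range d, (X - C (T * (k + 1))) + e with hf
  have hmonic : (∏ k ∈ Finset.range d, (X - C (T * ((k : ℤ) + 1)))).Monic :=
    monic_prod_of_monic _ _ fun k _ => monic_X_sub_C _
  have hdeg : (∏ k ∈ Finset.range d, (X - C (T * ((k : ℤ) + 1)))).degree = (d : WithBot ℕ) := by
    rw [degree_prod]
    simp only [degree_X_sub_C]
    simp
  have hfm : f.Monic := hmonic.add_of_left (hdeg ▸ he)
  have hfd : f.natDegree = d := natDegree_eq_of_degree_eq_some
    ((degree_add_eq_left_of_degree_lt (hdeg ▸ he)).trans hdeg)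
  have hsign : ∀ k ≤ d, 0 < (-1) ^ (d - k) * aeval ((T : ℝ) * (k + 1 / 2)) f := by
    intro k hk
    have h1 := hT k (Finset.mem_range.2 (Nat.lt_succ_of_le hk))
    have h2 := mul_le_mul_of_nonneg_left (half_pow_le_neg_one_pow_mul_prod hk)
      (pow_nonneg hT0'.le d)
    have h3 : aeval ((T : ℝ) * (k + 1 / 2)) f = (T : ℝ) ^ d *
        ∏ j ∈ Finset.range d, ((k : ℝ) + 1 / 2 - (j + 1)) + aeval ((T : ℝ) * (k + 1 / 2)) e := by
      rw [hf, map_add, map_prod]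
      congr 1
      have : ((T : ℝ)) ^ d = ∏ j ∈ Finset.range d, (T : ℝ) := by simp
      rw [this, ← Finset.prod_mul_distrib]
      refine Finset.prod_congr rfl fun j _ => ?_
      rw [map_sub, aeval_X, aeval_C]
      simp
      ring
    have h4 : -|aeval ((T : ℝ) * (k + 1 / 2)) e| ≤
        (-1) ^ (d - k) * aeval ((T : ℝ) * (k + 1 / 2)) e := by
      refine (neg_le_neg (le_of_eq ?_)).trans (neg_abs_le _)
      rw [abs_mul, abs_pow, abs_neg, abs_one, one_pow, one_mul]
    rw [h3, mul_add]
    linarith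
  obtain ⟨s, hs, hs0⟩ := exists_roots_of_alternating_signs (f := f.map (algebraMap ℤ ℝ)) (d := d)
    (c := fun k => (T : ℝ) * (k + 1 / 2))
    (fun i j hij => by
      have : (i : ℝ) < j := by exact_mod_cast hij
      simp only
      gcongr)
    (fun k hk => by
      have h1 := mul_pos (hsign k hk.le) (hsign (k + 1) hk)
      obtain ⟨m, rfl⟩ := Nat.exists_eq_add_of_lt hk
      rw [show k + m + 1 - k = m + 1 by omega, show k + m + 1 - (k + 1) = m by omega] at h1
      simp only [eval_map_algebraMap]
      have h2 : ((-1 : ℝ) ^ m) * (-1) ^ m = 1 := by rw [← mul_pow]; simp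
      push_cast at h1 ⊢
      generalize aeval ((T : ℝ) * (k + 1 / 2)) f = u at *
      generalize aeval ((T : ℝ) * (k + 1 + 1 / 2)) f = w at *
      have : (-1) ^ (m + 1) * u * ((-1) ^ m * w) = -(((-1 : ℝ) ^ m) * (-1) ^ m) * (u * w) := by
        ring
      rw [this, h2] at h1
      linarith)
  by_contra him
  let S : Finset ℂ := insert z (s.map ⟨Complex.ofReal, Complex.ofReal_injective⟩)
  have hS : S.card = d + 1 := by
    rw [Finset.card_insert_of_notMem, Finset.card_map, hs]
    intro hmem
    obtain ⟨x, -, rfl⟩ := Finset.mem_map.1 hmem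
    exact him (Complex.ofReal_im x)
  have h0 := eq_zero_of_natDegree_lt_card_of_eval_eq_zero' (f.map (algebraMap ℤ ℂ)) S
    (fun x hx => by
      rw [eval_map_algebraMap]
      rcases Finset.mem_insert.1 hx with rfl | hx
      · exact hz
      · obtain ⟨y, hy, rfl⟩ := Finset.mem_map.1 hx
        have := hs0 y hy
        rw [eval_map_algebraMap] at this
        have h := aeval_algebraMap_apply ℂ y f
        rw [this, map_zero] at h
        exact h)
    (by rw [hS, hfm.natDegree_map, hfd]; exact Nat.lt_succ_self d)
  exact (hfm.map (algebraMap ℤ ℂ)).ne_zero h0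

theorem Polynomial.exists_irreducible_real_roots_congr {P : ℤ[X]} (hP : P.Monic)
    (hd : 0 < P.natDegree) {M : ℕ} (hM : M ≠ 0) :
    ∃ f : ℤ[X], f.Monic ∧ f.natDegree = P.natDegree ∧ Irreducible f ∧
      C (M : ℤ) ∣ f - P ∧ ∀ z : ℂ, aeval z f = 0 → z.im = 0 := by
  set d := P.natDegree with hdd
  obtain ⟨q, hqM, hq⟩ := Nat.exists_infinite_primes (M + 1)
  have hcop : IsCoprime (M : ℤ) ((q : ℤ) ^ 2) :=
    IsCoprime.pow_right (Nat.Coprime.isCoprime ((Nat.coprime_of_lt_prime hM hqM hq).symm))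
  obtain ⟨u, w, huw⟩ := hcop
  have hC : ∀ {a b : ℤ}, a ∣ b → (C a : ℤ[X]) ∣ C b := fun h => _root_.map_dvd C h
  let e : ℤ[X] := C (w * q ^ 2) * (P - X ^ d) - C (u * M * q)
  have hPd : (P - X ^ d).degree < (d : WithBot ℕ) := by
    have hdeg : P.degree = d := degree_eq_natDegree hP.ne_zero
    rw [← hdeg]
    exact degree_sub_lt_left (by rw [degree_X_pow, hdeg]) hP.ne_zero (by simp [hP.leadingCoeff])
  have he : e.degree < d := by
    refine (degree_sub_le _ _).trans_lt (max_lt ?_ ?_)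
    · rw [C_mul']
      exact (degree_smul_le _ _).trans_lt hPd
    · exact degree_C_le.trans_lt (by exact_mod_cast hd)
  have hq0 : (q : ℤ) ≠ 0 := by exact_mod_cast hq.ne_zero
  have hMq : (0 : ℤ) < M * q ^ 2 := by positivity
  obtain ⟨t, ht, -⟩ := ((tendsto_id.const_mul_atTop' hMq).eventually
    (eventually_im_eq_zero_of_root he)).and (eventually_gt_atTop (0 : ℤ)) |>.exists
  set T : ℤ := M * q ^ 2 * id t
  set F : ℤ[X] := ∏ k ∈ Finset.range d, (X - C (T * (k + 1))) with hF
  have hFT : C T ∣ F - X ^ d := C_dvd_prod_X_sub_C_sub_X_pow T d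
  have hFm : F.Monic := monic_prod_of_monic _ _ fun k _ => monic_X_sub_C _
  have hFd : F.degree = d := by
    rw [hF, degree_prod]
    simp only [degree_X_sub_C]
    simp
  have hfm : (F + e).Monic := hFm.add_of_left (hFd ▸ he)
  have hfd : (F + e).natDegree = d := natDegree_eq_of_degree_eq_some
    ((degree_add_eq_left_of_degree_lt (hFd ▸ he)).trans hFd)
  refine ⟨F + e, hfm, hfd, ?_, ?_, ht⟩
  · have hqp : Prime (q : ℤ) := Nat.prime_iff_prime_int.1 hq
    have hT2 : (q : ℤ) ^ 2 ∣ T := ⟨M * t, by simp [T]; ring⟩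
    have hdvd : C (q : ℤ) ∣ F + e - X ^ d := by
      have h1 : C (q : ℤ) ∣ F - X ^ d :=
        (hC ((dvd_pow_self _ two_ne_zero).trans hT2)).trans hFT
      have h2 : C (q : ℤ) ∣ e := by
        refine dvd_sub (Dvd.dvd.mul_right (hC ?_) _) (hC (dvd_mul_left _ _))
        exact (dvd_pow_self _ two_ne_zero).mul_left _
      have := dvd_add h1 h2
      rwa [sub_add_eq_add_sub] at this
    have hEis : (F + e).IsEisensteinAt (Ideal.span {(q : ℤ)}) := by
      refine ⟨?_, fun {n} hn => ?_, ?_⟩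
      · rw [hfm.leadingCoeff, Ideal.mem_span_singleton]
        exact hqp.not_dvd_one
      · rw [hfd] at hn
        have := (C_dvd_iff_dvd_coeff _ _).1 hdvd n
        rw [coeff_sub, coeff_X_pow, if_neg hn.ne, sub_zero] at this
        exact Ideal.mem_span_singleton.2 this
      · rw [Ideal.span_singleton_pow, Ideal.mem_span_singleton]
        intro h
        have h1 := (C_dvd_iff_dvd_coeff _ _).1 ((hC hT2).trans hFT) 0
        rw [coeff_sub, coeff_X_pow, if_neg hd.ne, sub_zero] at h1
        have h2 : (q : ℤ) ^ 2 ∣ e.coeff 0 := by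
          rw [coeff_add] at h
          exact (dvd_add_right h1).1 h
        have h3 : e.coeff 0 = q ^ 2 * (w * (P - X ^ d).coeff 0 + w * q) - q := by
          simp only [e, coeff_sub, coeff_C_mul, coeff_C_zero]
          linear_combination (-(q : ℤ)) * huw
        rw [h3] at h2
        have h4 : (q : ℤ) ^ 2 ∣ q := (dvd_sub_right (dvd_mul_right _ _)).1 h2
        rw [pow_two] at h4
        have h5 : (q : ℤ) ∣ 1 := (mul_dvd_mul_iff_left hq0).1 (by simpa using h4)
        exact hqp.not_dvd_one h5
    exact hEis.irreducible ((Ideal.span_singleton_prime hq0).2 hqp) hfm.isPrimitive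
      (hfd ▸ hd)
  · have hMT : (M : ℤ) ∣ T := ⟨q ^ 2 * t, by simp [T]; ring⟩
    have h1 : F + e - P = (F - X ^ d) - C (M : ℤ) * (C u * (P - X ^ d) + C (u * q)) := by
      have h2 : C (w * q ^ 2) = (1 : ℤ[X]) - C (M : ℤ) * C u := by
        rw [← C_1, ← C_mul, ← C_sub]
        congr 1
        linear_combination huw
      have h3 : C (u * M * q) = C (M : ℤ) * C (u * q) := by
        rw [← C_mul]
        congr 1
        ring
      simp only [e]
      rw [h2, h3]
      ring
    rw [h1]
    exact dvd_sub ((hC hMT).trans hFT) (dvd_mul_right _ _)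

theorem Valuation.nonempty_completion_ringEquiv {K Γ₀ L : Type*} [Field K]
    [LinearOrderedCommGroupWithZero Γ₀] [NormedField L] [IsUltrametricDist L] [CompleteSpace L]
    (w : Valuation K Γ₀) {σ : K →+* L} (hσ : DenseRange σ)
    (h : ∀ y, w y ≤ 1 ↔ ‖σ y‖ ≤ 1) : Nonempty (w.Completion ≃+* L) := by
  let _ : NormedField K := NormedField.induced K L σ σ.injective
  have hiso : Isometry σ := AddMonoidHomClass.isometry_of_norm σ fun _ ↦ rfl
  have : IsUltrametricDist K := ⟨fun x y z ↦ by
    simpa only [hiso.dist_eq] using dist_triangle_max (σ x) (σ y) (σ z)⟩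
  let _ : Valued K NNReal := NormedField.toValued
  have heq : w.IsEquiv (NormedField.valuation (K := K)) :=
    Valuation.isEquiv_of_val_le_one fun {y} ↦ by
      rw [h, NormedField.valuation_apply, ← NNReal.coe_le_coe]; rfl
  let e : WithVal w ≃ᵤ K := WithVal.uniformEquiv rfl heq
  let τ : WithVal w →+* L := σ.comp (WithVal.equiv w).toRingHom
  have hτ : IsUniformInducing τ := hiso.isUniformInducing.comp e.isUniformInducing
  let pkg : AbstractCompletion (WithVal w) :=
    { space := L
      coe := τ
      uniformStruct := inferInstance
      complete := inferInstance
      separation := inferInstance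
      isUniformInducing := hτ
      dense := hσ.comp e.surjective.denseRange hiso.continuous }
  let f : w.Completion →+* L :=
    UniformSpace.Completion.extensionHom τ hτ.uniformContinuous.continuous
  let cPkg := UniformSpace.Completion.cPkg (α := WithVal w)
  exact ⟨RingEquiv.ofBijective f (Function.bijective_iff_has_inverse.2
    ⟨pkg.compare cPkg, congr_fun (pkg.inverse_compare cPkg), congr_fun (cPkg.inverse_compare pkg)⟩)⟩

theorem norm_le_one_of_isIntegral_int {L : Type*} [NormedField L] [IsUltrametricDist L] {x : L}
    (hx : IsIntegral ℤ x) : ‖x‖ ≤ 1 :=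
  (Valuation.integer.integers (NormedField.valuation (K := L))).mem_of_integral hx.tower_top

open IsDedekindDomain in
theorem NumberField.exists_heightOneSpectrum_of_denseRange {K L : Type*} [Field K] [NumberField K]
    [NormedField L] [IsUltrametricDist L] [CompleteSpace L] {σ : K →+* L} (hσ : DenseRange σ)
    {p : ℕ} (hp : p.Prime) (hpL : ‖(p : L)‖ < 1) :
    ∃ v : HeightOneSpectrum (NumberField.RingOfIntegers K),
      Ideal.comap (algebraMap ℤ (NumberField.RingOfIntegers K)) v.asIdeal = Ideal.span {(p : ℤ)} ∧
      (∀ y, v.valuation K y ≤ 1 ↔ ‖σ y‖ ≤ 1) ∧ Nonempty (v.adicCompletion K ≃+* L) := by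
  have hle : ∀ a : NumberField.RingOfIntegers K, ‖σ a‖ ≤ 1 := fun a ↦
    norm_le_one_of_isIntegral_int (a.isIntegral_coe.map σ.toIntAlgHom)
  let I : Ideal (NumberField.RingOfIntegers K) :=
    { carrier := {a | ‖σ a‖ < 1}
      add_mem' := fun {a b} ha hb ↦ by
        simp only [Set.mem_ofPred_eq, map_add] at ha hb ⊢
        exact (IsUltrametricDist.norm_add_le_max _ _).trans_lt (max_lt ha hb)
      zero_mem' := by simp
      smul_mem' := fun c a ha ↦ by
        simp only [Set.mem_ofPred_eq, smul_eq_mul, map_mul, norm_mul] at ha ⊢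
        exact mul_lt_one_of_nonneg_of_lt_one_right (hle c) (norm_nonneg _) ha }
  have hmem : ∀ a, a ∈ I ↔ ‖σ a‖ < 1 := fun a ↦ Iff.rfl
  have hpI : (p : NumberField.RingOfIntegers K) ∈ I := by rw [hmem]; simpa using hpL
  have hI : I.IsPrime := by
    refine ⟨fun h ↦ ?_, fun {a b} hab ↦ ?_⟩
    · have := (hmem 1).1 (h ▸ Submodule.mem_top)
      simp at this
    · by_contra! hc
      rw [hmem] at hab
      have h1 := le_antisymm (hle a) (not_lt.1 hc.1)
      have h2 := le_antisymm (hle b) (not_lt.1 hc.2)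
      simp [h1, h2] at hab
  let v : HeightOneSpectrum (NumberField.RingOfIntegers K) :=
    ⟨I, hI, fun h ↦ hp.ne_zero (by rw [h] at hpI; simpa using hpI)⟩
  have hfrac : ∀ y, v.valuation K y ≤ 1 → ∃ a : NumberField.RingOfIntegers K,
      ‖σ y‖ = ‖σ a‖ ∧ v.valuation K y = v.valuation K a := by
    intro y hy
    obtain ⟨a, d, had⟩ := v.exists_primeCompl_mul_eq_of_integer y hy
    have hd : ¬ ‖σ (d : NumberField.RingOfIntegers K)‖ < 1 := d.2
    have hd1 := le_antisymm (hle d) (not_lt.1 hd)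
    have hvd : v.valuation K (d : NumberField.RingOfIntegers K) = 1 := by
      refine le_antisymm (v.valuation_le_one _) (not_lt.1 fun h ↦ d.2 ?_)
      exact (v.valuation_lt_one_iff_mem _).1 h
    refine ⟨a, ?_, ?_⟩
    · have := congr_arg (fun z ↦ ‖σ z‖) had
      simpa [hd1] using this
    · have := congr_arg (v.valuation K) had
      rwa [map_mul, hvd, mul_one] at this
  have hval : ∀ y, v.valuation K y ≤ 1 ↔ ‖σ y‖ ≤ 1 := by
    refine fun y ↦ ⟨fun hy ↦ ?_, fun hy ↦ ?_⟩
    · obtain ⟨a, ha, -⟩ := hfrac y hy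
      exact ha ▸ hle a
    · by_contra! hv
      have hlt : v.valuation K y⁻¹ < 1 := by
        rw [map_inv₀]; exact inv_lt_one_of_one_lt₀ hv
      obtain ⟨a, ha, hva⟩ := hfrac _ hlt.le
      have : ‖σ a‖ < 1 := (v.valuation_lt_one_iff_mem a).1 (hva ▸ hlt)
      rw [← ha, map_inv₀, norm_inv] at this
      have hy0 : 0 < ‖σ y‖ := by
        rw [norm_pos_iff, _root_.map_ne_zero]
        rintro rfl
        simp at hv
      exact absurd this (not_lt.2 ((one_le_inv₀ hy0).2 hy))
  refine ⟨v, ?_, hval, ?_⟩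
  · have hmax : (Ideal.span {(p : ℤ)}).IsMaximal :=
      PrincipalIdealRing.isMaximal_of_irreducible (Nat.prime_iff_prime_int.1 hp).irreducible
    refine (hmax.eq_of_le (Ideal.comap_ne_top _ hI.ne_top) ?_).symm
    rw [Ideal.span_singleton_le_iff_mem, Ideal.mem_comap]
    simpa using hpI
  · obtain ⟨e⟩ := (v.valuation K).nonempty_completion_ringEquiv hσ hval
    exact ⟨(HeightOneSpectrum.adicCompletion.equiv K v).trans e⟩

theorem denseRange_of_adjoin_eq_top (p : ℕ) [Fact p.Prime] {K L : Type*} [Field K] [CharZero K]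
    [NormedField L] [NormedAlgebra ℚ_[p] L] (σ : K →+* L) {r : L}
    (hr : Algebra.adjoin ℚ_[p] {r} = ⊤) (hrσ : r ∈ Set.range σ) : DenseRange σ := by
  have hQ : ∀ c : ℚ_[p], algebraMap ℚ_[p] L c ∈ σ.range.topologicalClosure := by
    intro c
    refine (Padic.denseRange_ratCast p).induction_on
      (p := fun c ↦ algebraMap ℚ_[p] L c ∈ σ.range.topologicalClosure) c ?_ fun q ↦ ?_
    · exact σ.range.isClosed_topologicalClosure.preimage (continuous_algebraMap ℚ_[p] L)
    · exact σ.range.le_topologicalClosure ⟨(q : K), by simp⟩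
  intro x
  have hx : x ∈ Algebra.adjoin ℚ_[p] {r} := hr ▸ Algebra.mem_top
  change x ∈ σ.range.topologicalClosure
  induction hx using Algebra.adjoin_induction with
  | mem x hx =>
    obtain rfl := hx
    exact σ.range.le_topologicalClosure hrσ
  | algebraMap c => exact hQ c
  | add x y _ _ hx hy => exact add_mem hx hy
  | mul x y _ _ hx hy => exact mul_mem hx hy

theorem Padic.norm_intCast_of_normedAlgebra (p : ℕ) [Fact p.Prime] (L : Type*) [NormedField L]
    [NormedAlgebra ℚ_[p] L] (z : ℤ) : ‖(z : L)‖ = ‖(z : ℚ_[p])‖ := by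
  rw [← map_intCast (algebraMap ℚ_[p] L), norm_algebraMap']

theorem Padic.norm_natCast_of_normedAlgebra (p : ℕ) [Fact p.Prime] (L : Type*) [NormedField L]
    [NormedAlgebra ℚ_[p] L] (m : ℕ) : ‖(m : L)‖ = ‖(m : ℚ_[p])‖ := by
  rw [← map_natCast (algebraMap ℚ_[p] L), norm_algebraMap']

theorem Padic.norm_prime_lt_one_of_normedAlgebra (p : ℕ) [Fact p.Prime] (L : Type*) [NormedField L]
    [NormedAlgebra ℚ_[p] L] : ‖(p : L)‖ < 1 := by
  rw [Padic.norm_natCast_of_normedAlgebra p]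
  exact Padic.norm_p_lt_one

theorem Polynomial.exists_irreducible_real_roots_approx {ι : Type*} [Fintype ι] [Nonempty ι]
    (ℓ : ι → ℕ) [∀ i, Fact (ℓ i).Prime] (L : ι → Type*) [∀ i, NontriviallyNormedField (L i)]
    [∀ i, NormedAlgebra ℚ_[ℓ i] (L i)] [∀ i, FiniteDimensional ℚ_[ℓ i] (L i)]
    (c : ι → ℕ) (N : ℕ) :
    ∃ f : ℤ[X], f.Monic ∧ Irreducible f ∧ (∀ z : ℂ, aeval z f = 0 → z.im = 0) ∧
      ∀ i, ∃ r : L i, aeval r f = 0 ∧ Algebra.adjoin ℚ_[ℓ i] {r} = ⊤ ∧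
        ‖r - c i‖ ≤ ‖(ℓ i : L i) ^ N‖ := by
  have hcomplete : ∀ i, CompleteSpace (L i) := fun i ↦ FiniteDimensional.complete ℚ_[ℓ i] (L i)
  have hultra : ∀ i, IsUltrametricDist (L i) := fun i ↦
    IsUltrametricDist.of_normedAlgebra ℚ_[ℓ i]
  have hchar : ∀ i, CharZero (L i) := fun i ↦
    charZero_of_injective_algebraMap (algebraMap ℚ_[ℓ i] (L i)).injective
  choose b γ hγ hb hbtop using fun i ↦
    exists_isIntegral_adjoin_eq_top_near (ℓ i) (L := L i) (c i) N
  have hbint : ∀ i, IsIntegral ℤ (b i) := fun i ↦ by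
    rw [hb i]
    exact (isIntegral_natCast _).add (((isIntegral_natCast _).pow _).mul (hγ i))
  obtain ⟨P, hP, hPd, hPb⟩ := Polynomial.exists_monic_common_simple_roots hbint
  have hℓ0 : ∀ i, (0 : ℝ) < ‖(ℓ i : L i) ^ N‖ := fun i ↦
    norm_pos_iff.2 (pow_ne_zero _ (Nat.cast_ne_zero.2 (Fact.out : (ℓ i).Prime).ne_zero))
  have hU : ∀ i, {r : L i | Algebra.adjoin ℚ_[ℓ i] {r} = ⊤ ∧ ‖r - c i‖ ≤ ‖(ℓ i : L i) ^ N‖} ∈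
      𝓝 (b i) := fun i ↦ by
    filter_upwards [eventually_adjoin_eq_top (hbtop i), Metric.ball_mem_nhds (b i) (hℓ0 i)]
      with r hr hrb
    refine ⟨hr, ?_⟩
    have h1 : r - c i = (r - b i) + (ℓ i : L i) ^ N * γ i := by rw [hb i]; ring
    rw [h1]
    refine (IsUltrametricDist.norm_add_le_max _ _).trans (max_le ?_ ?_)
    · exact (mem_ball_iff_norm.1 hrb).le
    · rw [norm_mul]
      exact mul_le_of_le_one_right (norm_nonneg _) (norm_le_one_of_isIntegral_int (hγ i))
  have hroot := fun i ↦ Polynomial.exists_root_near (P := P.map (Int.castRingHom (L i)))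
    (d := P.natDegree) natDegree_map_le (b := b i) (by simpa [aeval_def, eval_map] using (hPb i).1)
    (by simpa [aeval_def, eval_map, derivative_map] using (hPb i).2) (hU i)
  choose ε hε hroot using hroot
  have hev : ∀ᶠ k in atTop, ∀ i, ‖(ℓ i : L i)‖ ^ k < ε i := eventually_all.2 fun i ↦
    (tendsto_pow_atTop_nhds_zero_of_lt_one (norm_nonneg _)
      (Padic.norm_prime_lt_one_of_normedAlgebra (ℓ i) (L i))).eventually_lt_const (hε i)
  obtain ⟨k, hk⟩ := hev.exists
  have hint : ∀ i (z : ℤ), ‖(z : L i)‖ ≤ 1 := fun i z ↦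
    norm_le_one_of_isIntegral_int (isIntegral_intCast z)
  have hM : ∀ i, ‖(((∏ j, ℓ j) ^ k : ℕ) : L i)‖ < ε i := fun i ↦ by
    obtain ⟨m, hm⟩ := Finset.dvd_prod_of_mem ℓ (Finset.mem_univ i)
    refine lt_of_le_of_lt ?_ (hk i)
    rw [Nat.cast_pow, norm_pow, hm, Nat.cast_mul, norm_mul]
    gcongr
    exact mul_le_of_le_one_right (norm_nonneg _) (by simpa using hint i m)
  obtain ⟨f, hf, hfd, hfirr, ⟨g, hg⟩, hfreal⟩ := Polynomial.exists_irreducible_real_roots_congr hP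
    hPd (M := (∏ j, ℓ j) ^ k)
    (pow_ne_zero _ (Finset.prod_ne_zero_iff.2 fun i _ ↦ (Fact.out : (ℓ i).Prime).ne_zero))
  refine ⟨f, hf, hfirr, hfreal, fun i ↦ ?_⟩
  obtain ⟨r, ⟨hr1, hr2⟩, hr⟩ := hroot i (f.map (Int.castRingHom (L i)))
    (natDegree_map_le.trans hfd.le) fun j ↦ by
      have h1 := congr_arg (fun q ↦ ‖((q.coeff j : ℤ) : L i)‖) hg
      simp only [coeff_sub, coeff_C_mul, Int.cast_sub, Int.cast_mul, norm_mul,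
        Int.cast_natCast] at h1
      rw [coeff_map, coeff_map, eq_intCast, eq_intCast, h1]
      exact (mul_le_of_le_one_right (norm_nonneg _) (hint i _)).trans_lt (hM i)
  exact ⟨r, by simpa [aeval_def, eval_map] using hr, hr1, hr2⟩

theorem NumberField.exists_totallyReal_dense_embeddings {ι : Type*} [Fintype ι] [Nonempty ι]
    (ℓ : ι → ℕ) [∀ i, Fact (ℓ i).Prime] (L : ι → Type*) [∀ i, NontriviallyNormedField (L i)]
    [∀ i, NormedAlgebra ℚ_[ℓ i] (L i)] [∀ i, FiniteDimensional ℚ_[ℓ i] (L i)]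
    (c : ι → ℕ) (N : ℕ) :
    ∃ (K : Type) (_ : Field K) (_ : NumberField K), (∀ (φ : K →+* ℂ) (x : K), (φ x).im = 0) ∧
      ∃ (σ : ∀ i, K →+* L i) (θ : K), ∀ i, DenseRange (σ i) ∧
        ‖σ i θ - c i‖ ≤ ‖(ℓ i : L i) ^ N‖ := by
  have hchar : ∀ i, CharZero (L i) := fun i ↦
    charZero_of_injective_algebraMap (algebraMap ℚ_[ℓ i] (L i)).injective
  obtain ⟨f, hf, hirr, hreal, hroot⟩ :=
    Polynomial.exists_irreducible_real_roots_approx ℓ L c N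
  choose r hr hrtop hrc using hroot
  let F : ℚ[X] := f.map (algebraMap ℤ ℚ)
  have hF : Irreducible F := (hf.irreducible_iff_irreducible_map_fraction_map).1 hirr
  have : Fact (Irreducible F) := ⟨hF⟩
  have hfin : FiniteDimensional ℚ (AdjoinRoot F) :=
    (AdjoinRoot.powerBasis hF.ne_zero).finite
  have hnf : NumberField (AdjoinRoot F) := { to_charZero := inferInstance, to_finiteDimensional := hfin }
  let σ : ∀ i, AdjoinRoot F →+* L i := fun i ↦
    AdjoinRoot.lift (algebraMap ℚ (L i)) (r i) (by
      rw [eval₂_map, ← hr i, aeval_def]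
      congr 1
      exact RingHom.ext_int _ _)
  have hσ : ∀ i, σ i (AdjoinRoot.root F) = r i := fun i ↦ AdjoinRoot.lift_root _
  refine ⟨AdjoinRoot F, inferInstance, hnf, fun φ x ↦ ?_, σ, AdjoinRoot.root F, fun i ↦ ⟨?_, ?_⟩⟩
  · have h0 : aeval (φ (AdjoinRoot.root F)) f = 0 := by
      have h1 := congr_arg φ (AdjoinRoot.eval₂_root F)
      rw [eval₂_map, hom_eval₂, map_zero] at h1
      rw [aeval_def, ← h1]
      congr 1
      exact RingHom.ext_int _ _
    have him := hreal _ h0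
    have hx : φ x ∈ Complex.ofRealHom.range := by
      induction x using AdjoinRoot.induction_on with
      | ih q =>
        induction q using Polynomial.induction_on' with
        | add p q hp hq =>
          rw [map_add, map_add]
          exact add_mem hp hq
        | monomial m a =>
          rw [← C_mul_X_pow_eq_monomial, map_mul, map_pow, map_mul, map_pow, AdjoinRoot.mk_X]
          refine mul_mem (RingHom.mem_range.2 ⟨(a : ℝ), ?_⟩)
            (pow_mem (RingHom.mem_range.2 ⟨(φ (AdjoinRoot.root F)).re, ?_⟩) _)
          · change _ = ((φ.comp (AdjoinRoot.mk F)).comp C) a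
            simp
          · exact Complex.ext (by simp) (by simp [him])
    obtain ⟨y, hy⟩ := hx
    simp [← hy]
  · exact denseRange_of_adjoin_eq_top (ℓ i) (σ i) (hrtop i) ⟨_, hσ i⟩
  · rw [hσ]
    exact hrc i

open IsDedekindDomain in
theorem NumberField.exists_totallyReal_completions (n : ℕ) (hn : 1 ≤ n) (ℓ : Fin n → ℕ)
    [∀ i, Fact (ℓ i).Prime] (L : Fin n → Type*) [∀ i, NontriviallyNormedField (L i)]
    [∀ i, NormedAlgebra ℚ_[ℓ i] (L i)] [∀ i, FiniteDimensional ℚ_[ℓ i] (L i)] :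
    ∃ (K : Type) (_ : Field K) (_ : NumberField K),
      (∀ (φ : K →+* ℂ) (x : K), (φ x).im = 0) ∧
      ∃ v : Fin n → HeightOneSpectrum (NumberField.RingOfIntegers K),
        Function.Injective v ∧
        (∀ i, Ideal.comap (algebraMap ℤ (NumberField.RingOfIntegers K))
            (v i).asIdeal = Ideal.span {((ℓ i : ℤ))}) ∧
        (∀ i, Nonempty (((v i).adicCompletion K) ≃+* L i)) := by
  have : Nonempty (Fin n) := ⟨⟨0, hn⟩⟩
  have hcomplete : ∀ i, CompleteSpace (L i) := fun i ↦ FiniteDimensional.complete ℚ_[ℓ i] (L i)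
  have hultra : ∀ i, IsUltrametricDist (L i) := fun i ↦
    IsUltrametricDist.of_normedAlgebra ℚ_[ℓ i]
  obtain ⟨K, hK, hnf, hreal, σ, θ, hσ⟩ :=
    NumberField.exists_totallyReal_dense_embeddings ℓ L (fun i ↦ (i : ℕ)) n
  choose v hv hval hcompl using fun i ↦ NumberField.exists_heightOneSpectrum_of_denseRange
    (hσ i).1 (Fact.out : (ℓ i).Prime) (Padic.norm_prime_lt_one_of_normedAlgebra (ℓ i) (L i))
  refine ⟨K, hK, hnf, hreal, v, fun i j hij ↦ ?_, hv, hcompl⟩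
  have hℓ : ℓ i = ℓ j := by
    have h1 : Ideal.span {(ℓ i : ℤ)} = Ideal.span {(ℓ j : ℤ)} := by rw [← hv, ← hv, hij]
    simpa [Ideal.span_singleton_eq_span_singleton, Int.associated_iff_natAbs] using h1
  have hle : ∀ k, (v k).valuation K ((θ - (k : ℕ)) / (ℓ k : K) ^ n) ≤ 1 := fun k ↦ by
    rw [hval, map_div₀, map_sub, map_pow, map_natCast, map_natCast, norm_div]
    exact div_le_one_of_le₀ (hσ k).2 (norm_nonneg _)
  have hsub : (v i).valuation K (((j : ℕ) - (i : ℕ)) / (ℓ i : K) ^ n) ≤ 1 := by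
    have h1 : (((j : ℕ) - (i : ℕ)) / (ℓ i : K) ^ n : K) =
        (θ - (i : ℕ)) / (ℓ i : K) ^ n - (θ - (j : ℕ)) / (ℓ i : K) ^ n := by ring
    rw [h1]
    refine (Valuation.map_sub _ _ _).trans (max_le (hle i) ?_)
    rw [hij, hℓ]
    exact hle j
  rw [hval, map_div₀, map_sub, map_pow, map_natCast, map_natCast, map_natCast, norm_div] at hsub
  have hpos : 0 < ‖(ℓ i : L i) ^ n‖ := by
    rw [norm_pow, Padic.norm_natCast_of_normedAlgebra (ℓ i)]
    exact pow_pos (norm_pos_iff.2 (Nat.cast_ne_zero.2 (Fact.out : (ℓ i).Prime).ne_zero)) n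
  rw [div_le_one hpos] at hsub
  have hdvd : ((ℓ i : ℤ) ^ n) ∣ (j : ℕ) - (i : ℕ) := by
    have h1 := Padic.norm_intCast_of_normedAlgebra (ℓ i) (L i) ((j : ℕ) - (i : ℕ))
    push_cast at h1
    rw [h1, norm_pow, Padic.norm_natCast_of_normedAlgebra (ℓ i), Padic.norm_p] at hsub
    have h2 := (Padic.norm_int_le_pow_iff_dvd (p := ℓ i) ((j : ℕ) - (i : ℕ)) n).1
      (by push_cast; simpa using hsub)
    exact_mod_cast h2
  have hlt : |((j : ℕ) - (i : ℕ) : ℤ)| < (ℓ i : ℤ) ^ n := by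
    have h1 : (n : ℤ) < (ℓ i : ℤ) ^ n := by
      exact_mod_cast Nat.lt_pow_self (Fact.out : (ℓ i).Prime).one_lt
    rw [abs_lt]
    have := i.2
    have := j.2
    constructor <;> linarith
  have := Int.eq_zero_of_abs_lt_dvd hdvd hlt
  exact Fin.ext (by linarith)

end

/-- Given prime numbers `ℓ_1, …, ℓ_n` and finite extensions `K_i/ℚ_{ℓ_i}`,
there exist a totally real number field `K` and distinct finite places
`v_1, …, v_n` of `K`, with `v_i` lying above `ℓ_i`, such that the completion of
`K` at `v_i` is isomorphic to `K_i` (as a `ℚ_{ℓ_i}`-algebra; note that a ring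
isomorphism between finite extensions of `ℚ_ℓ` is automatically
`ℚ_ℓ`-algebra-compatible). -/
theorem totally_real_with_prescribed_completions
    (n : ℕ) (hn : 1 ≤ n) (ℓ : Fin n → ℕ) [∀ i, Fact (ℓ i).Prime]
    (Kl : ∀ i, LocalFieldExt (ℓ i)) :
    ∃ (K : Type) (_ : Field K) (_ : NumberField K),
      (∀ (φ : K →+* ℂ) (x : K), (φ x).im = 0) ∧
      ∃ v : Fin n → HeightOneSpectrum (NumberField.RingOfIntegers K),
        Function.Injective v ∧
        (∀ i, Ideal.comap (algebraMap ℤ (NumberField.RingOfIntegers K))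
            (v i).asIdeal = Ideal.span {((ℓ i : ℤ))}) ∧
        (∀ i, Nonempty (((v i).adicCompletion K) ≃+* (Kl i).carrier)) := by
  let _ : ∀ i, NontriviallyNormedField (Kl i).carrier := fun i ↦
    spectralNorm.nontriviallyNormedField ℚ_[ℓ i] (Kl i).carrier
  let _ : ∀ i, NormedAlgebra ℚ_[ℓ i] (Kl i).carrier := fun i ↦
    spectralNorm.normedAlgebra ℚ_[ℓ i] (Kl i).carrier
  have : ∀ i, FiniteDimensional ℚ_[ℓ i] (Kl i).carrier := fun i ↦ (Kl i).finiteDimensional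
  exact NumberField.exists_totallyReal_completions n hn ℓ fun i ↦ (Kl i).carrier
end
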